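/- Let η > 0 and let H be a graph with χ(H) =: r ≥ 2. Let σ := σ(H), h := |H| and ω := (h − σ)/(r − 1). Then there exists an integer n₁ = n₁(η, H) such that if G is a graph on n ≥ n₁ vertices, h divides n, and either (i) or (ii) below holds, then G contains a perfect H-tiling: (i) hcf(H) = 1 and the degree sequence d₁ ≤ … ≤ d_n of G satisfies d_i ≥ (1 − (ω + σ)/h)·n + (σ/ω)·i + ηn for all 1 ≤ i ≤ ωn/h; (ii) hcf(H) ≠ 1 and the degree sequence d₁ ≤ … ≤ d_n of G satisfies d_i ≥ (r − 2)n/r + i + ηn for all i < n/r. -/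

import Mathlib

open SimpleGraph

/-- The degree of a vertex, as the cardinality of its neighbour set. -/
noncomputable def degN {V : Type*} (G : SimpleGraph V) (v : V) : ℕ :=
  (G.neighborSet v).ncard

/-- `f` is a copy of `H` in `G`: an injective map preserving adjacency. -/
def IsCopy {α β : Type*} (H : SimpleGraph α) (G : SimpleGraph β) (f : α → β) : Prop :=
  Function.Injective f ∧ ∀ ⦃u v : α⦄, H.Adj u v → G.Adj (f u) (f v)

/-- An `H`-tiling in `G`: a collection of vertex-disjoint copies of `H` in `G`. -/
def IsTiling {α β : Type*} (H : SimpleGraph α) (G : SimpleGraph β) (T : Set (α → β)) : Prop :=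
  (∀ f ∈ T, IsCopy H G f) ∧
    T.Pairwise fun f g => Disjoint (Set.range f) (Set.range g)

/-- `G` contains a perfect `H`-tiling. -/
def HasPerfectTiling {α β : Type*} (H : SimpleGraph α) (G : SimpleGraph β) : Prop :=
  ∃ T : Set (α → β), IsTiling H G T ∧ ∀ v : β, ∃ f ∈ T, v ∈ Set.range f

/-- `σ(H)` relative to `r` colours: the smallest possible size of a colour class in
any proper colouring of `H` with `r` colours. -/
noncomputable def minClassSize {α : Type*} (H : SimpleGraph α) (r : ℕ) : ℕ :=
  sInf {s : ℕ | ∃ (c : H.Coloring (Fin r)) (i : Fin r), s = {v | c v = i}.ncard}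

/-- `hcf_χ(H) = 1`: the highest common factor of all differences of colour class sizes
over optimal colourings is 1 (equivalently, no `d ≥ 2` divides all such differences). -/
def HcfChiOne {α : Type*} (H : SimpleGraph α) (r : ℕ) : Prop :=
  ∀ d : ℕ, 2 ≤ d →
    ¬ ∀ (c : H.Coloring (Fin r)) (i j : Fin r),
        (d : ℤ) ∣ (({v | c v = i}.ncard : ℤ) - ({v | c v = j}.ncard : ℤ))

/-- `hcf_χ(H) ≤ 2`: some difference of colour class sizes is nonzero (so `hcf_χ(H) ≠ ∞`)
and no `d ≥ 3` divides all such differences. -/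
def HcfChiLeTwo {α : Type*} (H : SimpleGraph α) (r : ℕ) : Prop :=
  (∃ (c : H.Coloring (Fin r)) (i j : Fin r),
      {v | c v = i}.ncard ≠ {v | c v = j}.ncard) ∧
    ∀ d : ℕ, 3 ≤ d →
      ¬ ∀ (c : H.Coloring (Fin r)) (i j : Fin r),
          (d : ℤ) ∣ (({v | c v = i}.ncard : ℤ) - ({v | c v = j}.ncard : ℤ))

/-- `hcf_c(H) = 1`: the highest common factor of the orders of the components of `H` is 1. -/
def HcfCompOne {α : Type*} (H : SimpleGraph α) : Prop :=
  ∀ d : ℕ, 2 ≤ d → ∃ C : H.ConnectedComponent, ¬ d ∣ C.supp.ncard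

/-- `hcf(H) = 1` for a graph `H` with `χ(H) = r`. -/
def HcfOne {α : Type*} (H : SimpleGraph α) (r : ℕ) : Prop :=
  (r = 2 → HcfCompOne H ∧ HcfChiLeTwo H 2) ∧ (r ≠ 2 → HcfChiOne H r)

open Finset in
/-- Optimal solution of a linear program with equality constraints, together with a dual solution
satisfying complementary slackness. -/
theorem exists_lp_optimum {K Y : Type*} [Fintype K] [Fintype Y] [DecidableEq Y]
    (g : K → Y → ℝ) (c : K → ℝ)
    (μ : Y → ℝ) (hg : ∀ k y, 0 ≤ g k y) (hμ : ∀ y, 0 < μ y)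
    (hgk : ∀ k, ∃ y, 0 < g k y) (single : Y → K) (β : ℝ) (hβ : 0 < β)
    (hsingle : ∀ y y', g (single y) y' = if y = y' then β else 0) :
    ∃ (w : K → ℝ) (z : Y → ℝ), (∀ k, 0 ≤ w k) ∧ (∀ y, ∑ k, w k * g k y = μ y) ∧
      (∀ k, 0 ≤ ∑ y, g k y * z y + c k) ∧
      (∀ k, 0 < w k → ∑ y, g k y * z y + c k = 0) := by
  classical
  have key : ∀ v : Y → ℝ, (∀ y, 0 ≤ v y) → ∃ w : K → ℝ, (∀ k, 0 ≤ w k) ∧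
      (∀ y, ∑ k, w k * g k y = v y) ∧ ∑ k, w k * c k = ∑ y, v y / β * c (single y) := by
    intro v hv
    refine ⟨fun k => ∑ y, if single y = k then v y / β else 0, fun k => ?_, fun y => ?_, ?_⟩
    · exact sum_nonneg fun y _ => by split_ifs <;> [exact div_nonneg (hv y) hβ.le; exact le_rfl]
    · simp_rw [sum_mul]
      rw [sum_comm]
      simp only [ite_mul, zero_mul, sum_ite_eq, mem_univ, if_true, hsingle, mul_ite, mul_zero,
        sum_ite_eq']
      field_simp
    · simp_rw [sum_mul]
      rw [sum_comm]
      simp only [ite_mul, zero_mul, sum_ite_eq, mem_univ, if_true]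
  let F : Set (K → ℝ) := {w | (∀ k, 0 ≤ w k) ∧ ∀ y, ∑ k, w k * g k y = μ y}
  have hFne : F.Nonempty := by
    obtain ⟨w, h1, h2, -⟩ := key μ fun y => (hμ y).le
    exact ⟨w, h1, h2⟩
  have hFclosed : IsClosed F := by
    have : F = (⋂ k, {w : K → ℝ | 0 ≤ w k}) ∩ ⋂ y, {w : K → ℝ | ∑ k, w k * g k y = μ y} := by
      ext w; simp [F]
    rw [this]
    refine IsClosed.inter (isClosed_iInter fun k => isClosed_le (by fun_prop) (by fun_prop))
      (isClosed_iInter fun y => isClosed_eq (by fun_prop) (by fun_prop))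
  have hFcompact : IsCompact F := by
    choose y0 hy0 using hgk
    refine IsCompact.of_isClosed_subset
      (isCompact_Icc (a := (0 : K → ℝ)) (b := fun k => μ (y0 k) / g k (y0 k))) hFclosed ?_
    rintro w ⟨h1, h2⟩
    refine ⟨h1, fun k => ?_⟩
    rw [le_div_iff₀ (hy0 k), ← h2]
    exact single_le_sum (f := fun k' => w k' * g k' (y0 k))
      (fun k' _ => mul_nonneg (h1 k') (hg k' _)) (mem_univ k)
  obtain ⟨w, hwF, hwmin⟩ := hFcompact.exists_isMinOn hFne
    (f := fun w : K → ℝ => ∑ k, w k * c k) (by fun_prop)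
  set cs := ∑ k, w k * c k with hcs
  let A : Set ((Y → ℝ) × ℝ) := {p | ∃ w : K → ℝ, (∀ k, 0 ≤ w k) ∧
    (∀ y, ∑ k, w k * g k y = p.1 y) ∧ ∑ k, w k * c k ≤ p.2}
  have hAconv : Convex ℝ A := by
    rintro p ⟨u, hu0, hu1, hu2⟩ q ⟨v, hv0, hv1, hv2⟩ s t hs ht hst
    refine ⟨fun k => s * u k + t * v k, fun k => ?_, fun y => ?_, ?_⟩
    · have := hu0 k; have := hv0 k; positivity
    · simp only [add_mul, mul_assoc, sum_add_distrib, ← mul_sum, hu1, hv1]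
      simp
    · simp only [add_mul, mul_assoc, sum_add_distrib, ← mul_sum]
      simp only [Prod.snd_add, Prod.smul_snd, smul_eq_mul]
      gcongr
  have hAint : (interior A).Nonempty := by
    let U : Set ((Y → ℝ) × ℝ) := {p | (∀ y, 0 < p.1 y) ∧ ∑ y, p.1 y / β * c (single y) < p.2}
    have hU : IsOpen U := by
      have : U = (⋂ y, {p : (Y → ℝ) × ℝ | 0 < p.1 y}) ∩
          {p | ∑ y, p.1 y / β * c (single y) < p.2} := by
        ext w; simp [U]
      rw [this]
      exact (isOpen_iInter_of_finite fun y => isOpen_lt (by fun_prop) (by fun_prop)).inter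
        (isOpen_lt (by fun_prop) (by fun_prop))
    have hUA : U ⊆ A := by
      rintro p ⟨h1, h2⟩
      obtain ⟨w, h3, h4, h5⟩ := key p.1 fun y => (h1 y).le
      exact ⟨w, h3, h4, h5 ▸ h2.le⟩
    exact ⟨(μ, ∑ y, μ y / β * c (single y) + 1), interior_maximal hUA hU ⟨hμ, by simp⟩⟩
  have hxint : ((μ, cs) : (Y → ℝ) × ℝ) ∉ interior A := by
    intro hx
    have hcont : Filter.Tendsto (fun δ : ℝ => ((μ, cs - δ) : (Y → ℝ) × ℝ))
        (nhdsWithin 0 (Set.Ioi 0)) (nhds (μ, cs)) := by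
      have : Continuous (fun δ : ℝ => ((μ, cs - δ) : (Y → ℝ) × ℝ)) := by fun_prop
      have h2 := this.tendsto 0
      rw [sub_zero] at h2
      exact h2.mono_left nhdsWithin_le_nhds
    have h1 := hcont.eventually (mem_interior_iff_mem_nhds.1 hx)
    obtain ⟨δ, hδ, hδ0⟩ := (h1.and self_mem_nhdsWithin).exists
    obtain ⟨v, hv0, hv1, hv2⟩ := hδ
    have := hwmin (show v ∈ F from ⟨hv0, hv1⟩)
    simp only [Set.mem_ofPred_eq] at this hδ0 hv2
    linarith
  obtain ⟨f, hf0, hfA⟩ := geometric_hahn_banach_of_nonempty_interior_point hAconv hxint hAint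
  have hcone : ∀ p ∈ A, f p ≤ 0 := by
    rintro p ⟨u, hu0, hu1, hu2⟩
    by_contra! hp
    obtain ⟨n, hn⟩ := exists_nat_gt (f (μ, cs) / f p)
    have := hfA ((n : ℝ) • p) ⟨fun k => n * u k, fun k => mul_nonneg n.cast_nonneg (hu0 k),
      fun y => by simp [mul_assoc, ← mul_sum, hu1], by
        simp only [mul_assoc, ← mul_sum, Prod.smul_snd, smul_eq_mul]; gcongr⟩
    rw [map_smul, smul_eq_mul] at this
    rw [div_lt_iff₀ hp] at hn
    linarith
  have hxA : ((μ, cs) : (Y → ℝ) × ℝ) ∈ A := ⟨w, hwF.1, hwF.2, le_rfl⟩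
  have hfx : f (μ, cs) = 0 := by
    refine le_antisymm (hcone _ hxA) ?_
    have := hfA 0 ⟨0, by simp, by simp, by simp⟩
    simpa using this
  let ξ : Y → ℝ := fun y => f (Pi.single y 1, 0)
  set θ : ℝ := f (0, 1) with hθ
  have hf : ∀ p, f p = ∑ y, p.1 y * ξ y + p.2 * θ := by
    intro p
    have : p = ∑ y, p.1 y • ((Pi.single y 1, 0) : (Y → ℝ) × ℝ) + p.2 • ((0, 1) : (Y → ℝ) × ℝ) := by
      ext y
      · simp [Prod.fst_sum, Finset.sum_apply, Pi.single_apply]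
      · simp [Prod.snd_sum]
    conv_lhs => rw [this]
    rw [map_add, map_sum]
    simp only [map_smul, smul_eq_mul, ξ, θ]
  have hgA : ∀ k, ∑ y, g k y * ξ y + c k * θ ≤ 0 := by
    intro k
    rw [← hf (g k, c k)]
    refine hcone _ ⟨Pi.single k 1, fun k' => ?_, by simp [Pi.single_apply], by
      simp [Pi.single_apply]⟩
    simp only [Pi.single_apply]; split_ifs <;> norm_num
  have hθ0 : θ ≤ 0 := hcone _ ⟨0, by simp, by simp, by simp⟩
  have hθneg : θ < 0 := by
    refine lt_of_le_of_ne hθ0 fun h0 => hf0 ?_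
    have h1 : ∀ y, ξ y ≤ 0 := by
      intro y
      have := hgA (single y)
      simp only [hsingle, ite_mul, zero_mul, sum_ite_eq, mem_univ, if_true, h0, mul_zero,
        add_zero] at this
      by_contra! h; nlinarith [mul_pos hβ h]
    have h2 : ∑ y, μ y * ξ y = 0 := by
      have := hf (μ, cs); rw [hfx, h0] at this; simpa using this.symm
    have h3 : ∀ y, ξ y = 0 := by
      intro y
      have := (sum_eq_zero_iff_of_nonpos fun y _ =>
        mul_nonpos_of_nonneg_of_nonpos (hμ y).le (h1 y)).1 h2 y (mem_univ y)
      exact (mul_eq_zero.1 this).resolve_left (hμ y).ne'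
    ext p <;> simp [hf, h3, h0]
  have hz : ∀ k, 0 ≤ ∑ y, g k y * (ξ y / θ) + c k := by
    intro k
    have h1 : ∑ y, g k y * (ξ y / θ) + c k = (∑ y, g k y * ξ y + c k * θ) / θ := by
      rw [add_div, sum_div, mul_div_assoc (c k), div_self hθneg.ne, mul_one]
      simp [mul_div_assoc]
    rw [h1]
    exact div_nonneg_of_nonpos (hgA k) hθ0
  refine ⟨w, fun y => ξ y / θ, hwF.1, hwF.2, hz, fun k hk => ?_⟩
  have hsum : ∑ k, w k * (∑ y, g k y * (ξ y / θ) + c k) = 0 := by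
    have h1 := hf (μ, cs)
    rw [hfx] at h1
    simp only at h1
    simp only [mul_add, sum_add_distrib, mul_sum]
    rw [sum_comm]
    have h2 : ∀ y, ∑ k, w k * (g k y * (ξ y / θ)) = μ y * ξ y / θ := by
      intro y
      rw [← hwF.2 y, sum_mul, sum_div]
      exact sum_congr rfl fun k _ => by ring
    simp only [h2, ← hcs]
    rw [← sum_div, div_add' _ _ _ hθneg.ne, ← h1, zero_div]
  have := (sum_eq_zero_iff_of_nonneg fun k _ => mul_nonneg (hwF.1 k) (hz k)).1 hsum k (mem_univ k)
  exact (mul_eq_zero.1 this).resolve_left hk.ne'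

open Finset Classical in
theorem degN_eq_card {V : Type*} [Fintype V] (G : SimpleGraph V) (v : V) :
    degN G v = #{w | G.Adj v w} := by
  rw [degN, ← Set.ncard_coe_finset]
  congr 1
  ext; simp

/-- The robust form of the degree sequence condition: every nonempty set of vertices contains a
vertex of large degree. -/
def DegCond {Y : Type*} [Fintype Y] (R : SimpleGraph Y) (q : ℕ) (a ρ η : ℝ) : Prop :=
  ∀ S : Finset Y, S.Nonempty → ∃ x ∈ S,
    q * a * Fintype.card Y + ρ * min (S.card : ℝ) (a * Fintype.card Y) + η * Fintype.card Y
      ≤ degN R x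

/-- The weight of the part `j` in a bottle with neck weight `ρ * a`. -/
noncomputable def partWeight {q : ℕ} (a ρ : ℝ) (j : Fin (q + 2)) : ℝ := if j = 0 then ρ * a else a

open Finset in
theorem sum_partWeight {q : ℕ} {a ρ : ℝ} (hsum : (q + 1) * a + ρ * a = 1) :
    ∑ j : Fin (q + 2), partWeight a ρ j = 1 := by
  rw [Fin.sum_univ_succ]
  simp only [partWeight, Fin.succ_ne_zero, if_true, if_false, sum_const, card_univ, Fintype.card_fin,
    nsmul_eq_mul]
  push_cast
  linarith

theorem partWeight_pos {q : ℕ} {a ρ : ℝ} (ha : 0 < a) (hρ : 0 < ρ) (j : Fin (q + 2)) :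
    0 < partWeight a ρ j := by
  unfold partWeight; split_ifs <;> positivity

open Finset Classical in
/-- The weight distribution of a weighted clique. -/
noncomputable def bottleVec {Y : Type*} {q : ℕ} (a ρ : ℝ) (κ : Fin (q + 2) → Y) :
    Y → ℝ :=
  fun y => ∑ j, if κ j = y then partWeight a ρ j else 0

section Fractional

variable {Y : Type*} [Fintype Y] {R : SimpleGraph Y} {q : ℕ} {a ρ η : ℝ}

/-- Tiles: cliques some of whose vertices may be a universal dummy vertex. -/
def IsTile (R : SimpleGraph Y) (κ : Fin (q + 2) → Option Y) : Prop :=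
  Pairwise fun i j => ∀ x ∈ κ i, ∀ y ∈ κ j, R.Adj x y

theorem IsTile.update {κ : Fin (q + 2) → Option Y} (hκ : IsTile R κ) (j : Fin (q + 2)) (x : Y)
    (h : ∀ i, i ≠ j → ∀ y ∈ κ i, R.Adj x y) : IsTile R (Function.update κ j (some x)) := by
  intro i i' hii' u hu v hv
  by_cases h1 : i = j
  · subst h1
    rw [Function.update_self, Option.mem_some_iff] at hu
    rw [Function.update_of_ne hii'.symm] at hv
    exact hu ▸ h i' hii'.symm v hv
  · rw [Function.update_of_ne h1] at hu
    by_cases h2 : i' = j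
    · subst h2
      rw [Function.update_self, Option.mem_some_iff] at hv
      exact hv ▸ (h i h1 u hu).symm
    · rw [Function.update_of_ne h2] at hv
      exact hκ hii' u hu v hv

open Finset Classical in
/-- A vertex `x` minimising the dual solution sees little of any tight tile. -/
theorem tile_mass_le (ha : 0 < a) (hρ : 0 < ρ) (hρ1 : ρ ≤ 1) (hsum : (q + 1) * a + ρ * a = 1)
    (z : Option Y → ℝ) (hfeas : ∀ κ : Fin (q + 2) → Option Y, IsTile R κ →
      0 ≤ ∑ j, partWeight a ρ j * z (κ j)) (x : Y) (hx : ∀ o, z (some x) ≤ z o)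
    (hneg : z (some x) < 0) (κ : Fin (q + 2) → Option Y) (hκ : IsTile R κ)
    (htight : ∑ j, partWeight a ρ j * z (κ j) = 0) :
    (∑ j, if ∀ y ∈ κ j, R.Adj x y then partWeight a ρ j else 0) ≤ 1 - a ∧
    (∑ j, if ∀ y ∈ κ j, R.Adj x y then partWeight a ρ j else 0) ≤
      q * a + ρ * ∑ j, if z (κ j) = z (some x) then partWeight a ρ j else 0 := by
  have hw : ∀ j : Fin (q + 2), 0 < partWeight a ρ j := partWeight_pos ha hρ
  have hρa : ρ * a ≤ a := by nlinarith
  have hnotall : ¬ ∀ j, z (κ j) ≤ z (some x) := by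
    intro h
    have : ∑ j, partWeight a ρ j * z (κ j) < ∑ j : Fin (q + 2), 0 :=
      sum_lt_sum_of_nonempty univ_nonempty fun j _ =>
        mul_neg_of_pos_of_neg (hw j) ((h j).trans_lt hneg)
    simp [htight] at this
  have hswap : ∀ j, (∀ i, i ≠ j → ∀ y ∈ κ i, R.Adj x y) → z (κ j) ≤ z (some x) := by
    intro j hj
    have h1 := hfeas _ (hκ.update j x hj)
    rw [← add_sum_erase univ _ (mem_univ j)] at h1 htight
    have h2 : ∑ i ∈ univ.erase j, partWeight a ρ i * z (Function.update κ j (some x) i) =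
        ∑ i ∈ univ.erase j, partWeight a ρ i * z (κ i) :=
      sum_congr rfl fun i hi => by rw [Function.update_of_ne (ne_of_mem_erase hi)]
    rw [h2, Function.update_self] at h1
    have := hw j
    nlinarith
  have hnonneg : 0 ≤ ∑ j, if z (κ j) = z (some x) then partWeight a ρ j else 0 :=
    sum_nonneg fun j _ => by split_ifs <;> [exact (hw j).le; exact le_rfl]
  have hmass : (∑ j, if ∀ y ∈ κ j, R.Adj x y then partWeight a ρ j else 0) =
      1 - ∑ j, if ∀ y ∈ κ j, R.Adj x y then 0 else partWeight a ρ j := by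
    rw [eq_sub_iff_add_eq, ← sum_add_distrib, ← sum_partWeight hsum]
    exact sum_congr rfl fun j _ => by split_ifs <;> simp
  have hmiss0 : ∀ j, 0 ≤ if ∀ y ∈ κ j, R.Adj x y then 0 else partWeight a ρ j :=
    fun j => by split_ifs <;> [exact le_rfl; exact (hw j).le]
  obtain ⟨j, hj⟩ : ∃ j, ¬ ∀ y ∈ κ j, R.Adj x y := by
    by_contra! h
    exact hnotall fun j => hswap j fun i _ => h i
  by_cases huniq : ∀ i, i ≠ j → ∀ y ∈ κ i, R.Adj x y
  · have hzj : z (κ j) = z (some x) := le_antisymm (hswap j huniq) (hx _)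
    have hwj : partWeight a ρ j = a := by
      by_contra hne
      have hj0 : j = 0 := by by_contra h0; exact hne (by simp [partWeight, h0])
      have hlt : ρ * a < a := lt_of_le_of_ne hρa (by simpa [partWeight, hj0] using hne)
      refine hnotall fun i => ?_
      by_cases hi : i = j
      · rw [hi, hzj]
      have h1 := hfeas (κ ∘ Equiv.swap j i)
        fun k l hkl => hκ ((Equiv.swap j i).injective.ne hkl)
      have hji : i ∈ univ.erase j := mem_erase.2 ⟨hi, mem_univ i⟩
      rw [← add_sum_erase univ _ (mem_univ j), ← add_sum_erase _ _ hji] at h1 htight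
      have h2 : ∑ k ∈ (univ.erase j).erase i, partWeight a ρ k * z ((κ ∘ Equiv.swap j i) k) =
          ∑ k ∈ (univ.erase j).erase i, partWeight a ρ k * z (κ k) :=
        sum_congr rfl fun k hk => by
          have h3 := ne_of_mem_erase hk
          have h4 := ne_of_mem_erase (mem_of_mem_erase hk)
          rw [Function.comp_apply, Equiv.swap_apply_of_ne_of_ne h4 h3]
      rw [h2] at h1
      have h5 : partWeight a ρ j = ρ * a := by simp [partWeight, hj0]
      have h6 : partWeight a ρ i = a := by simp [partWeight, ← hj0, hi]
      simp only [Function.comp_apply, Equiv.swap_apply_left, Equiv.swap_apply_right, h5, h6] at h1 htight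
      rw [← hzj]
      nlinarith
    have h1 : a ≤ ∑ j, if ∀ y ∈ κ j, R.Adj x y then 0 else partWeight a ρ j := by
      have := single_le_sum (fun j _ => hmiss0 j) (mem_univ j)
      rwa [if_neg hj, hwj] at this
    have h2 : a ≤ ∑ j, if z (κ j) = z (some x) then partWeight a ρ j else 0 := by
      have := single_le_sum (f := fun j => if z (κ j) = z (some x) then partWeight a ρ j else 0)
        (fun j _ => by split_ifs <;> [exact (hw j).le; exact le_rfl]) (mem_univ j)
      rwa [if_pos hzj, hwj] at this
    rw [hmass]
    constructor <;> nlinarith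
  · push Not at huniq
    obtain ⟨i, hij, hi⟩ := huniq
    have hi' : ¬ ∀ y ∈ κ i, R.Adj x y := by push Not; exact hi
    have h1 : a + ρ * a ≤ ∑ j, if ∀ y ∈ κ j, R.Adj x y then 0 else partWeight a ρ j := by
      have h3 := sum_le_sum_of_subset_of_nonneg (subset_univ {i, j})
        (f := fun j => if ∀ y ∈ κ j, R.Adj x y then 0 else partWeight a ρ j)
        fun j _ _ => hmiss0 j
      rw [sum_pair hij, if_neg hj, if_neg hi'] at h3
      refine le_trans ?_ h3
      unfold partWeight
      split_ifs with h4 h5 h5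
      · exact absurd (h4.trans h5.symm) hij
      · linarith
      · linarith
      · linarith
    rw [hmass]
    have : 0 ≤ ρ * ∑ j, if z (κ j) = z (some x) then partWeight a ρ j else 0 :=
      mul_nonneg hρ.le hnonneg
    have : 0 < ρ * a := mul_pos hρ ha
    constructor <;> linarith

open Finset Classical in
theorem exists_fractional_clique_tiling (ha : 0 < a) (hρ : 0 < ρ) (hρ1 : ρ ≤ 1)
    (hsum : (q + 1) * a + ρ * a = 1) (hR : DegCond R q a ρ η) {δ : ℝ} (hδ : δ < η) (hδ1 : δ < 1)
    (μ : Y → ℝ) (hμ : ∀ y, 1 - δ ≤ μ y ∧ μ y ≤ 1) :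
    ∃ w : (Fin (q + 2) → Y) → ℝ, (∀ κ, 0 ≤ w κ) ∧
      (∀ κ, w κ ≠ 0 → Pairwise fun i j => R.Adj (κ i) (κ j)) ∧
      ∑ κ, w κ • bottleVec a ρ κ = μ := by
  have hw : ∀ j : Fin (q + 2), 0 < partWeight a ρ j := partWeight_pos ha hρ
  let K := {κ : Fin (q + 2) → Option Y // IsTile R κ ∧ ∃ j, κ j ≠ none}
  let g : K → Y → ℝ := fun κ y => ∑ j, if κ.1 j = some y then partWeight a ρ j else 0
  let c : K → ℝ := fun κ => ∑ j, if κ.1 j = none then partWeight a ρ j else 0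
  have hterm : ∀ (P : Prop) [Decidable P] (j : Fin (q + 2)), 0 ≤ if P then partWeight a ρ j else 0 :=
    fun P _ j => by split_ifs <;> [exact (hw j).le; exact le_rfl]
  have hg : ∀ k y, 0 ≤ g k y := fun k y => sum_nonneg fun j _ => hterm _ j
  have hc : ∀ k, 0 ≤ c k := fun k => sum_nonneg fun j _ => hterm _ j
  have hgk : ∀ k, ∃ y, 0 < g k y := by
    rintro ⟨κ, hκ, j, hj⟩
    obtain ⟨y, hy⟩ := Option.ne_none_iff_exists'.1 hj
    exact ⟨y, sum_pos' (fun j _ => hterm _ j) ⟨j, mem_univ j, by simpa [hy] using hw j⟩⟩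
  let single : Y → K := fun y => ⟨fun j => if j = 0 then some y else none, by
    intro i j hij u hu v hv
    by_cases hi : i = 0
    · have : j ≠ 0 := fun h => hij (hi.trans h.symm)
      simp [this] at hv
    · simp [hi] at hu, 0, by simp⟩
  obtain ⟨w, z, hw0, hwμ, hfeas, htight⟩ := exists_lp_optimum g c μ hg
    (fun y => by have := hμ y; linarith) hgk single (ρ * a) (mul_pos hρ ha) (by
      intro y y'
      simp only [g, single]
      rw [Fin.sum_univ_succ]
      simp [partWeight])
  let z' : Option Y → ℝ := fun o => o.elim 1 z
  have hz' : ∀ κ : Fin (q + 2) → Option Y, ∑ j, partWeight a ρ j * z' (κ j) =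
      ∑ y, (∑ j, if κ j = some y then partWeight a ρ j else 0) * z y +
        ∑ j, if κ j = none then partWeight a ρ j else 0 := by
    intro κ
    simp_rw [sum_mul]
    rw [sum_comm, ← sum_add_distrib]
    refine sum_congr rfl fun j _ => ?_
    rcases h : κ j with _ | y <;> simp [z']
  have hfeas' : ∀ κ : Fin (q + 2) → Option Y, IsTile R κ →
      0 ≤ ∑ j, partWeight a ρ j * z' (κ j) := by
    intro κ hκ
    by_cases h : ∃ j, κ j ≠ none
    · rw [hz']; exact hfeas ⟨κ, hκ, h⟩
    · push Not at h
      exact sum_nonneg fun j _ => by simp [h, z', (hw j).le]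
  set cost := ∑ k, w k * c k with hcost
  have hcost0 : 0 ≤ cost := sum_nonneg fun k _ => mul_nonneg (hw0 k) (hc k)
  have hswap : ∀ f : Y → ℝ, ∑ k, w k * ∑ y, g k y * f y = ∑ y, μ y * f y := by
    intro f
    simp_rw [mul_sum]
    rw [sum_comm]
    refine sum_congr rfl fun y _ => ?_
    rw [← hwμ y, sum_mul]
    exact sum_congr rfl fun k _ => by ring
  have hdual : ∑ y, μ y * z y = - cost := by
    rw [← hswap, eq_neg_iff_add_eq_zero, hcost, ← sum_add_distrib]
    refine sum_eq_zero fun k _ => ?_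
    rw [← mul_add]
    rcases (hw0 k).eq_or_lt with h | h
    · rw [← h, zero_mul]
    · rw [htight k h, mul_zero]
  have hcost' : cost = 0 := by
    by_contra hne
    have hpos : 0 < cost := lt_of_le_of_ne hcost0 (Ne.symm hne)
    obtain ⟨y0, hy0⟩ : ∃ y, z y < 0 := by
      by_contra! h
      have : 0 ≤ ∑ y, μ y * z y :=
        sum_nonneg fun y _ => mul_nonneg (by have := hμ y; linarith) (h y)
      linarith
    obtain ⟨x0, -, hx0⟩ := exists_min_image univ z ⟨y0, mem_univ _⟩
    obtain ⟨x, hxS, hxdeg⟩ := hR (univ.filter fun y => z y = z x0) ⟨x0, by simp⟩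
    rw [mem_filter] at hxS
    have hxneg : z' (some x) < 0 := by
      have := hx0 y0 (mem_univ _)
      change z x < 0
      linarith [hxS.2]
    have hxmin : ∀ o, z' (some x) ≤ z' o := by
      rintro (_ | y)
      · change _ ≤ (1 : ℝ); linarith
      · change z x ≤ z y; rw [hxS.2]; exact hx0 y (mem_univ _)
    set M : ℝ := (Fintype.card Y : ℝ) with hM
    have hMpos : 0 < M := by
      have : Nonempty Y := ⟨x0⟩
      exact Nat.cast_pos.2 Fintype.card_pos
    have hmass : ∀ k : K, w k * (∑ j, if ∀ y ∈ k.1 j, R.Adj x y then partWeight a ρ j else 0) ≤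
        w k * (1 - a) ∧
        w k * (∑ j, if ∀ y ∈ k.1 j, R.Adj x y then partWeight a ρ j else 0) ≤
        w k * (q * a + ρ * ∑ j, if z' (k.1 j) = z' (some x) then partWeight a ρ j else 0) := by
      intro k
      rcases (hw0 k).eq_or_lt with h | h
      · simp [← h]
      · have := tile_mass_le ha hρ hρ1 hsum z' hfeas' x hxmin hxneg k.1 k.2.1
          (by rw [hz']; exact htight k h)
        exact ⟨mul_le_mul_of_nonneg_left this.1 h.le, mul_le_mul_of_nonneg_left this.2 h.le⟩
    have hpred : ∀ (Q : Option Y → Prop) [DecidablePred Q] (k : K),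
        (∑ j, if Q (k.1 j) then partWeight a ρ j else 0) =
          (∑ y, g k y * if Q (some y) then 1 else 0) + if Q none then c k else 0 := by
      intro Q _ k
      simp only [g, c]
      have : (if Q none then ∑ j, (if k.1 j = none then partWeight a ρ j else 0) else 0) =
          ∑ j, if Q none then (if k.1 j = none then partWeight a ρ j else 0) else 0 := by
        split_ifs <;> simp
      simp_rw [sum_mul]
      rw [sum_comm, this, ← sum_add_distrib]
      refine sum_congr rfl fun j _ => ?_
      rcases h : k.1 j with _ | y
      · simp
      · rw [sum_eq_single y (fun x _ hx => by simp [hx.symm]) (by simp)]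
        by_cases hQ : Q (some y) <;> simp [hQ]
    have hpred' : ∀ (Q : Option Y → Prop) [DecidablePred Q],
        ∑ k, w k * (∑ j, if Q (k.1 j) then partWeight a ρ j else 0) =
          (∑ y, μ y * if Q (some y) then 1 else 0) + if Q none then cost else 0 := by
      intro Q _
      simp_rw [hpred Q, mul_add, sum_add_distrib]
      rw [hswap]
      congr 1
      split_ifs <;> simp [hcost]
    have htot : ∑ k, w k ≤ M + cost := by
      have := hpred' fun _ => True
      simp only [if_true, sum_partWeight hsum, mul_one] at this
      rw [this]
      have h1 : ∑ y, μ y ≤ ∑ y : Y, (1 : ℝ) := sum_le_sum fun y _ => (hμ y).2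
      simp only [sum_const, card_univ, nsmul_eq_mul, mul_one] at h1
      linarith
    have hN : degN R x - δ * M + cost ≤
        ∑ k, w k * (∑ j, if ∀ y ∈ k.1 j, R.Adj x y then partWeight a ρ j else 0) := by
      rw [hpred' fun o => ∀ y ∈ o, R.Adj x y]
      simp only [Option.mem_def, Option.some.injEq, forall_eq', reduceCtorEq, false_imp_iff,
        implies_true, if_true]
      have h1 : ∑ y, ((if R.Adj x y then (1 : ℝ) else 0) - δ) ≤
          ∑ y, μ y * if R.Adj x y then 1 else 0 := by
        refine sum_le_sum fun y _ => ?_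
        have := hμ y
        split_ifs <;> linarith
      rw [sum_sub_distrib, sum_boole, ← degN_eq_card] at h1
      simp only [sum_const, card_univ, nsmul_eq_mul] at h1
      linarith
    have hS : ∑ k, w k * (∑ j, if z' (k.1 j) = z' (some x) then partWeight a ρ j else 0) ≤
        (univ.filter fun y => z y = z x0).card := by
      rw [hpred' fun o => z' o = z' (some x), if_neg (by change ¬ (1 : ℝ) = _; linarith), add_zero,
        ← sum_boole]
      refine sum_le_sum fun y _ => ?_
      change μ y * (if z y = z x then 1 else 0) ≤ _
      rw [hxS.2]
      have := hμ y
      split_ifs <;> linarith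
    have hqa : (q : ℝ) * a ≤ 1 := by nlinarith
    have ha1 : 1 - a = q * a + ρ * a := by linarith
    have hb1 : degN R x - δ * M + cost ≤ (M + cost) * (1 - a) := by
      refine hN.trans ((sum_le_sum fun k _ => (hmass k).1).trans ?_)
      rw [← sum_mul]
      refine mul_le_mul_of_nonneg_right htot ?_
      rw [ha1]; positivity
    have hb2 : degN R x - δ * M + cost ≤ (M + cost) * (q * a) +
        ρ * (univ.filter fun y => z y = z x0).card := by
      refine hN.trans ((sum_le_sum fun k _ => (hmass k).2).trans ?_)
      have : ∀ k : K, w k * (q * a + ρ * ∑ j, if z' (k.1 j) = z' (some x) then partWeight a ρ j else 0)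
          = w k * (q * a) + ρ * (w k * ∑ j, if z' (k.1 j) = z' (some x) then partWeight a ρ j else 0) :=
        fun k => by ring
      simp_rw [this, sum_add_distrib, ← sum_mul, ← mul_sum]
      gcongr
    have hδM : δ * M < η * M := mul_lt_mul_of_pos_right hδ hMpos
    have h1 : cost * (1 - a) ≤ cost := by nlinarith
    have h2 : cost * (q * a) ≤ cost := by nlinarith
    rcases min_choice ((univ.filter fun y => z y = z x0).card : ℝ) (a * M) with h | h
    · rw [h] at hxdeg; nlinarith
    · rw [h] at hxdeg
      have : ρ * (a * M) = M * (ρ * a) := by ring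
      rw [add_mul, ha1] at hb1
      rw [ha1] at h1
      nlinarith
  have hck : ∀ k, w k ≠ 0 → ∀ j, k.1 j ≠ none := by
    intro k hk j hj
    have h1 := (sum_eq_zero_iff_of_nonneg fun k _ => mul_nonneg (hw0 k) (hc k)).1 hcost' k
      (mem_univ k)
    have h2 := (mul_eq_zero.1 h1).resolve_left hk
    have h3 := (sum_eq_zero_iff_of_nonneg fun j _ => hterm _ j).1 h2 j (mem_univ j)
    rw [if_pos hj] at h3
    exact (hw j).ne' h3
  let emb : {κ : Fin (q + 2) → Y // IsTile R fun j => some (κ j)} → K :=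
    fun κ => ⟨fun j => some (κ.1 j), κ.2, 0, by simp⟩
  have hemb : Function.Injective emb := by
    intro κ κ' h
    apply Subtype.ext
    funext j
    exact Option.some_injective _ (congrFun (congrArg Subtype.val h) j)
  refine ⟨fun κ => if h : IsTile R (fun j => some (κ j)) then w (emb ⟨κ, h⟩) else 0, fun κ => ?_,
    fun κ hκ => ?_, ?_⟩
  · dsimp only; split_ifs <;> [exact hw0 _; exact le_rfl]
  · by_cases h : IsTile R fun j => some (κ j)
    · exact fun i j hij => h hij _ rfl _ rfl
    · simp [h] at hκ
  · funext y
    rw [← hwμ y]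
    simp only [Finset.sum_apply, Pi.smul_apply, smul_eq_mul, dite_mul, zero_mul]
    rw [sum_dite, sum_const_zero, add_zero]
    have h1 : ∑ k, w k * g k y = ∑ k ∈ univ.map ⟨emb, hemb⟩, w k * g k y := by
      symm
      refine sum_subset (subset_univ _) fun k _ hk => ?_
      by_contra hne
      have h2 := hck k (left_ne_zero_of_mul hne)
      choose f hf using fun j => Option.ne_none_iff_exists'.1 (h2 j)
      have h3 : k.1 = fun j => some (f j) := funext hf
      exact hk (mem_map.2 ⟨⟨f, h3 ▸ k.2.1⟩, mem_univ _, Subtype.ext h3.symm⟩)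
    rw [h1, sum_map]
    refine sum_bij' (fun κ _ => ⟨κ.1, (mem_filter.1 κ.2).2⟩)
      (fun κ _ => ⟨κ.1, mem_filter.2 ⟨mem_univ _, κ.2⟩⟩) ?_ ?_ ?_ ?_ ?_
    · simp
    · simp
    · simp
    · simp
    · intro κ _
      simp [bottleVec, g, emb]

end Fractional

section HomWeights

variable {α Y : Type*} [Fintype α]

open Finset in
/-- The number of vertices which a map sends to a given vertex. -/
def homVec [DecidableEq Y] (ψ : α → Y) (y : Y) : ℕ := #{u | ψ u = y}

open Finset in
theorem sum_homVec [DecidableEq Y] [Fintype Y] (ψ : α → Y) :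
    ∑ y, homVec ψ y = Fintype.card α :=
  (card_eq_sum_card_fiberwise (f := ψ) (s := univ) (t := univ) (by simp)).symm

open Finset in
/-- Averaging over the permutations in `P`, a colouring of `H` becomes a bottle. -/
def IsBottleAveraging {H : SimpleGraph α} {q : ℕ} (a ρ : ℝ) (c : H.Coloring (Fin (q + 2)))
    (P : Finset (Equiv.Perm (Fin (q + 2)))) : Prop :=
  P.Nonempty ∧ ∀ k, ∑ π ∈ P, (#{u | c u = π⁻¹ k} : ℝ) = #P * Fintype.card α * partWeight a ρ k

variable {H : SimpleGraph α} {R : SimpleGraph Y} {q : ℕ} {a ρ η : ℝ}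

/-- A colouring followed by a clique is a homomorphism. -/
def homOfClique {k : ℕ} (c : H.Coloring (Fin k)) (κ : Fin k → Y)
    (hκ : Pairwise fun i j => R.Adj (κ i) (κ j)) : H →g R :=
  ⟨fun u => κ (c u), fun h => hκ (c.valid h)⟩

open Finset in
theorem sum_class_card {k : ℕ} (c : α → Fin k) : ∑ i, #{u | c u = i} = Fintype.card α :=
  (card_eq_sum_card_fiberwise (f := c) (s := univ) (t := univ) (by simp)).symm

open Finset in
theorem isBottleAveraging_univ [Nonempty α] (c : H.Coloring (Fin (q + 2))) :
    IsBottleAveraging (1 / (q + 2)) 1 c univ := by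
  refine ⟨univ_nonempty, ?_⟩
  set S : Fin (q + 2) → ℝ := fun k => ∑ π : Equiv.Perm (Fin (q + 2)), (#{u | c u = π⁻¹ k} : ℝ)
    with hS
  have hconst : ∀ k, S k = S 0 := by
    intro k
    refine Fintype.sum_equiv (Equiv.mulLeft (Equiv.swap 0 k)) _ _ fun π => ?_
    simp
  have htot : ∑ k, S k = #(univ : Finset (Equiv.Perm (Fin (q + 2)))) * Fintype.card α := by
    rw [hS, sum_comm, ← nsmul_eq_mul, ← sum_const]
    refine sum_congr rfl fun π _ => ?_
    rw [← sum_class_card (fun u => c u), Nat.cast_sum]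
    exact Fintype.sum_equiv π⁻¹ _ _ fun k => rfl
  intro k
  have hq : (0 : ℝ) < q + 2 := by positivity
  have h1 : (q + 2) * S k = #(univ : Finset (Equiv.Perm (Fin (q + 2)))) * Fintype.card α := by
    rw [← htot, sum_congr rfl fun k _ => hconst k, hconst k]
    simp
  change S k = _
  rw [← h1]
  simp only [partWeight, one_mul, ite_self]
  field_simp

open Finset in
theorem isBottleAveraging_neck (c : H.Coloring (Fin (q + 2))) (i : Fin (q + 2))
    (hρ : ρ * a * Fintype.card α = #{u | c u = i})
    (hsum : (q + 1) * a + ρ * a = 1) :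
    IsBottleAveraging a ρ c (univ.filter fun π => π i = 0) := by
  set P := univ.filter fun π : Equiv.Perm (Fin (q + 2)) => π i = 0 with hP
  refine ⟨⟨Equiv.swap i 0, by simp [hP]⟩, ?_⟩
  set S : Fin (q + 2) → ℝ := fun k => ∑ π ∈ P, (#{u | c u = π⁻¹ k} : ℝ) with hS
  have hconst : ∀ k : Fin (q + 1), S k.succ = S 1 := by
    intro k
    have h : ∀ π ∈ P, Equiv.swap 1 k.succ * π ∈ P := by
      intro π hπ
      simp only [hP, mem_filter, mem_univ, true_and] at hπ ⊢
      rw [Equiv.Perm.mul_apply, hπ]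
      exact Equiv.swap_apply_of_ne_of_ne (by simp) (Fin.succ_ne_zero k).symm
    refine sum_bij' (fun π _ => Equiv.swap 1 k.succ * π) (fun π _ => Equiv.swap 1 k.succ * π)
      h h ?_ ?_ ?_
    · simp [← mul_assoc]
    · simp [← mul_assoc]
    · simp
  have h0 : S 0 = #P * (ρ * a * Fintype.card α) := by
    rw [hρ, ← nsmul_eq_mul, ← sum_const]
    refine sum_congr rfl fun π hπ => ?_
    simp only [hP, mem_filter, mem_univ, true_and] at hπ
    rw [← hπ, ← Equiv.Perm.mul_apply, inv_mul_cancel, Equiv.Perm.one_apply]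
  have htot : ∑ k, S k = #P * Fintype.card α := by
    rw [hS, sum_comm, ← nsmul_eq_mul, ← sum_const]
    refine sum_congr rfl fun π _ => ?_
    rw [← sum_class_card (fun u => c u), Nat.cast_sum]
    exact Fintype.sum_equiv π⁻¹ _ _ fun k => rfl
  intro k
  change S k = _
  rcases Fin.eq_zero_or_eq_succ k with rfl | ⟨j, rfl⟩
  · rw [h0]; simp [partWeight]; ring
  · rw [Fin.sum_univ_succ, h0, sum_congr rfl fun k _ => hconst k] at htot
    simp only [sum_const, card_univ, Fintype.card_fin, nsmul_eq_mul] at htot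
    push_cast at htot
    rw [hconst]
    simp only [partWeight, Fin.succ_ne_zero, if_false]
    have hq : (0 : ℝ) < q + 1 := by positivity
    have h1 : (q + 1) * S 1 = (q + 1) * (#P * Fintype.card α * a) := by
      linear_combination htot - #P * Fintype.card α * hsum
    exact mul_left_cancel₀ hq.ne' h1

open Finset in
theorem exists_hom_weights_bottleVec [DecidableEq Y] [Fintype (H →g R)]
    {c : H.Coloring (Fin (q + 2))} {P : Finset (Equiv.Perm (Fin (q + 2)))}
    (hα : 0 < Fintype.card α) (hP : IsBottleAveraging a ρ c P) (κ : Fin (q + 2) → Y)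
    (hκ : Pairwise fun i j => R.Adj (κ i) (κ j)) :
    ∃ w : (H →g R) → ℝ, (∀ ψ, 0 ≤ w ψ) ∧ ∀ y, ∑ ψ, w ψ * homVec ψ y = bottleVec a ρ κ y := by
  classical
  have hκ' : ∀ π : Equiv.Perm (Fin (q + 2)), Pairwise fun i j => R.Adj (κ (π i)) (κ (π j)) :=
    fun π i j hij => hκ (π.injective.ne hij)
  let Ψ : Equiv.Perm (Fin (q + 2)) → (H →g R) := fun π => homOfClique c _ (hκ' π)
  have hcard : (0 : ℝ) < #P * Fintype.card α := by
    have := hP.1.card_pos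
    positivity
  refine ⟨fun ψ => ∑ π ∈ P, if Ψ π = ψ then 1 / (#P * Fintype.card α : ℝ) else 0,
    fun ψ => sum_nonneg fun π _ => by split_ifs <;> positivity, fun y => ?_⟩
  simp_rw [sum_mul]
  rw [sum_comm]
  simp only [ite_mul, zero_mul, sum_ite_eq, mem_univ, if_true]
  have h1 : ∀ π, (homVec (Ψ π) y : ℝ) = ∑ k, if κ k = y then (#{u | c u = π⁻¹ k} : ℝ) else 0 := by
    intro π
    rw [homVec, card_eq_sum_card_fiberwise (f := fun u => π (c u)) (t := univ) (by simp)]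
    push_cast
    refine sum_congr rfl fun k _ => ?_
    rw [filter_filter]
    have : ∀ u, ((Ψ π) u = y ∧ π (c u) = k) ↔ (κ k = y ∧ c u = π⁻¹ k) := by
      intro u
      rw [Equiv.Perm.eq_inv_iff_eq]
      constructor
      · rintro ⟨h, rfl⟩; exact ⟨h, rfl⟩
      · rintro ⟨h, rfl⟩; exact ⟨h, rfl⟩
    simp_rw [this]
    split_ifs with h <;> simp [h]
  simp_rw [h1, mul_sum]
  rw [sum_comm]
  refine sum_congr rfl fun k _ => ?_
  split_ifs with h
  · rw [← mul_sum, hP.2 k]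
    have := hP.1.card_pos
    field_simp
  · simp

open Finset in
theorem exists_pos_hom_weights [Fintype Y] [DecidableEq Y] [Fintype (H →g R)]
    (ha : 0 < a) (hρ : 0 < ρ) (hρ1 : ρ ≤ 1) (hsum : (q + 1) * a + ρ * a = 1) (hη : 0 < η)
    (hR : DegCond R q a ρ η) {c : H.Coloring (Fin (q + 2))}
    {P : Finset (Equiv.Perm (Fin (q + 2)))} (hα : 0 < Fintype.card α)
    (hP : IsBottleAveraging a ρ c P) :
    ∃ w : (H →g R) → ℝ, (∀ ψ, 0 < w ψ) ∧ ∀ y, ∑ ψ, w ψ * homVec ψ y = 1 := by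
  classical
  set B : ℝ := ∑ y : Y, ∑ ψ : H →g R, (homVec ψ y : ℝ) with hB
  have hB0 : 0 ≤ B := by positivity
  have hBy : ∀ y, ∑ ψ : H →g R, (homVec ψ y : ℝ) ≤ B := fun y =>
    single_le_sum (f := fun y => ∑ ψ : H →g R, (homVec ψ y : ℝ)) (fun y _ => by positivity)
      (mem_univ y)
  set δ := min (η / 2) (1 / 2) with hδ
  have hδ0 : 0 < δ := by positivity
  set ε := δ / (B + 1) with hε
  have hε0 : 0 < ε := by positivity
  have hεB : ε * B ≤ δ := by
    rw [hε, div_mul_eq_mul_div, div_le_iff₀ (by positivity)]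
    nlinarith
  obtain ⟨w, hw0, hwR, hwμ⟩ := exists_fractional_clique_tiling (δ := δ) ha hρ hρ1 hsum hR
    ((min_le_left _ _).trans_lt (by linarith)) ((min_le_right _ _).trans_lt (by norm_num))
    (fun y => 1 - ε * ∑ ψ : H →g R, (homVec ψ y : ℝ)) fun y => by
      have h1 := mul_le_mul_of_nonneg_left (hBy y) hε0.le
      have h2 : 0 ≤ ε * ∑ ψ : H →g R, (homVec ψ y : ℝ) := by positivity
      constructor <;> linarith
  have hex : ∀ κ, ∃ v : (H →g R) → ℝ, (∀ ψ, 0 ≤ v ψ) ∧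
      ∀ y, ∑ ψ, v ψ * homVec ψ y = w κ * bottleVec a ρ κ y := by
    intro κ
    by_cases h : w κ = 0
    · exact ⟨0, fun _ => le_rfl, by simp [h]⟩
    · obtain ⟨v, hv0, hv⟩ := exists_hom_weights_bottleVec hα hP κ (hwR κ h)
      refine ⟨fun ψ => w κ * v ψ, fun ψ => mul_nonneg (hw0 κ) (hv0 ψ), fun y => ?_⟩
      rw [← hv, mul_sum]
      exact sum_congr rfl fun ψ _ => by ring
  choose v hv0 hv using hex
  refine ⟨fun ψ => ∑ κ, v κ ψ + ε, fun ψ => ?_, fun y => ?_⟩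
  · have : 0 ≤ ∑ κ, v κ ψ := sum_nonneg fun κ _ => hv0 κ ψ
    positivity
  · have h1 := congrFun hwμ y
    simp only [Finset.sum_apply, Pi.smul_apply, smul_eq_mul] at h1
    simp_rw [add_mul, sum_add_distrib, sum_mul, ← mul_sum]
    rw [sum_comm]
    simp_rw [hv]
    rw [h1]
    ring

end HomWeights

theorem pairwise_adj_cons {Y : Type*} {R : SimpleGraph Y} {k : ℕ} {x : Y} {κ : Fin k → Y}
    (hκ : Pairwise fun i j => R.Adj (κ i) (κ j)) (hx : ∀ i, R.Adj x (κ i)) :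
    Pairwise fun i j => R.Adj ((Fin.cons x κ : Fin (k + 1) → Y) i)
      ((Fin.cons x κ : Fin (k + 1) → Y) j) := by
  intro i j hij
  rcases Fin.eq_zero_or_eq_succ i with rfl | ⟨i, rfl⟩ <;>
    rcases Fin.eq_zero_or_eq_succ j with rfl | ⟨j, rfl⟩
  · exact absurd rfl hij
  · simpa using hx j
  · simpa using (hx i).symm
  · simpa using hκ fun h => hij (congrArg _ h)

section Cliques

variable {Y : Type*} [Fintype Y] {R : SimpleGraph Y} {q : ℕ} {a ρ η : ℝ}

/-- Vertices which miss only slightly less than `a * |Y|` vertices. -/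
def IsBig (R : SimpleGraph Y) (a η : ℝ) (x : Y) : Prop :=
  (1 - a + η) * Fintype.card Y ≤ degN R x

theorem DegCond.exists_isBig (hR : DegCond R q a ρ η) (hsum : (q + 1) * a + ρ * a = 1)
    {N : Finset Y} (hN : N.Nonempty) (hcard : a * Fintype.card Y ≤ N.card) :
    ∃ x ∈ N, IsBig R a η x := by
  obtain ⟨x, hx, hdeg⟩ := hR N hN
  refine ⟨x, hx, ?_⟩
  rw [min_eq_right hcard] at hdeg
  unfold IsBig
  linear_combination hdeg - Fintype.card Y * hsum

theorem DegCond.le_degN (hR : DegCond R q a ρ η) (ha : 0 < a) (hρ : 0 < ρ) (x : Y) :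
    (q * a + η) * Fintype.card Y ≤ degN R x := by
  obtain ⟨y, hy, hdeg⟩ := hR {x} (Finset.singleton_nonempty x)
  rw [Finset.mem_singleton] at hy
  subst hy
  have : 0 ≤ ρ * min ((({y} : Finset Y).card : ℕ) : ℝ) (a * Fintype.card Y) := by positivity
  linarith

open Finset Classical in
theorem card_add_degN_le (R : SimpleGraph Y) (N : Finset Y) (x : Y) :
    (#N : ℝ) + degN R x ≤ #{y ∈ N | R.Adj x y} + Fintype.card Y := by
  rw [degN_eq_card]
  have h1 := card_union_add_card_inter N ({y | R.Adj x y} : Finset Y)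
  have h2 : #(N ∪ ({y | R.Adj x y} : Finset Y)) ≤ Fintype.card Y := card_le_univ _
  have h3 : N ∩ ({y | R.Adj x y} : Finset Y) = {y ∈ N | R.Adj x y} := by ext; simp
  rw [h3] at h1
  have : #N + #({y | R.Adj x y} : Finset Y) ≤ #{y ∈ N | R.Adj x y} + Fintype.card Y := by omega
  exact_mod_cast this

open Finset Classical in
theorem IsBig.card_filter {x : Y} (hx : IsBig R a η x) (hη : 0 ≤ η) (N : Finset Y) :
    (#N : ℝ) - a * Fintype.card Y ≤ #{y ∈ N | R.Adj x y} := by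
  have h1 := card_add_degN_le R N x
  unfold IsBig at hx
  have : 0 ≤ η * Fintype.card Y := by positivity
  linarith

open Finset Classical in
theorem card_commonNbrs {k : ℕ} (κ : Fin k → Y) (hη : 0 ≤ η) (hκ : ∀ i, IsBig R a η (κ i))
    (N : Finset Y) :
    (#N : ℝ) - k * a * Fintype.card Y ≤ #{y ∈ N | ∀ i, R.Adj (κ i) y} := by
  induction k generalizing N with
  | zero => simp
  | succ k ih =>
    have h1 := ih (fun i => κ i.succ) (fun i => hκ i.succ) {y ∈ N | R.Adj (κ 0) y}
    have h2 := (hκ 0).card_filter hη N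
    rw [filter_filter] at h1
    simp_rw [Fin.forall_fin_succ]
    push_cast
    linarith

variable [Nonempty Y]

open Finset Classical in
theorem DegCond.exists_clique (hR : DegCond R q a ρ η) (hsum : (q + 1) * a + ρ * a = 1)
    (ha : 0 < a) (hη : 0 ≤ η) {ε : ℝ} (hε : 0 < ε) (k : ℕ) (N : Finset Y)
    (hN : (k * a + ε) * Fintype.card Y ≤ #N) :
    ∃ κ : Fin (k + 1) → Y, (Pairwise fun i j => R.Adj (κ i) (κ j)) ∧ (∀ i, κ i ∈ N) ∧
      ∀ i : Fin k, IsBig R a η (κ i.castSucc) := by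
  have hM : (0 : ℝ) < Fintype.card Y := Nat.cast_pos.2 Fintype.card_pos
  have hne : N.Nonempty := by
    rw [← card_pos]
    have : (0 : ℝ) < #N := lt_of_lt_of_le (by positivity) hN
    exact_mod_cast this
  induction k generalizing N with
  | zero =>
    obtain ⟨x, hx⟩ := hne
    exact ⟨fun _ => x, fun i j hij => (hij (Fin.ext (by omega))).elim, fun _ => hx,
      fun i => i.elim0⟩
  | succ k ih =>
    have haM : 0 ≤ k * a * Fintype.card Y := by positivity
    have hεM : 0 < ε * Fintype.card Y := by positivity
    push_cast at hN
    obtain ⟨x, hxN, hx⟩ := hR.exists_isBig hsum hne (by linarith)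
    have h1 := hx.card_filter hη N
    have h2 : (k * a + ε) * Fintype.card Y ≤ #{y ∈ N | R.Adj x y} := by linarith
    obtain ⟨κ, hκ, hκN, hbig⟩ := ih _ h2 (by
      rw [← card_pos]
      have : (0 : ℝ) < #{y ∈ N | R.Adj x y} := lt_of_lt_of_le (by linarith) h2
      exact_mod_cast this)
    simp only [mem_filter] at hκN
    refine ⟨Fin.cons x κ, pairwise_adj_cons hκ fun i => (hκN i).2, fun i => ?_, fun i => ?_⟩
    · rcases Fin.eq_zero_or_eq_succ i with rfl | ⟨i, rfl⟩
      · simpa using hxN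
      · simpa using (hκN i).1
    · rcases k with _ | k
      · obtain rfl : i = 0 := Fin.ext (by omega)
        simpa using hx
      · rcases Fin.eq_zero_or_eq_succ i with rfl | ⟨i, rfl⟩
        · simpa using hx
        · simpa using hbig i

open Finset Classical in
theorem DegCond.exists_clique_nbr (hR : DegCond R q a ρ η) (hsum : (q + 1) * a + ρ * a = 1)
    (ha : 0 < a) (hρ : 0 < ρ) (hη : 0 < η) {ε : ℝ} (hε : 0 < ε) (N : Finset Y)
    (hN : (q * a + ε) * Fintype.card Y ≤ #N) :
    ∃ (κ : Fin (q + 1) → Y) (w : Y), (Pairwise fun i j => R.Adj (κ i) (κ j)) ∧ (∀ i, κ i ∈ N) ∧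
      ∀ i, R.Adj w (κ i) := by
  have hM : (0 : ℝ) < Fintype.card Y := Nat.cast_pos.2 Fintype.card_pos
  obtain ⟨κ, hκ, hκN, hbig⟩ := hR.exists_clique hsum ha hη.le hε q N hN
  have h1 := card_commonNbrs (fun i : Fin q => κ i.castSucc) hη.le hbig
    {y | R.Adj (κ (Fin.last q)) y}
  rw [← degN_eq_card] at h1
  have h2 := hR.le_degN ha hρ (κ (Fin.last q))
  have h3 : (0 : ℝ) < η * Fintype.card Y := by positivity
  have h4 : (0 : ℝ) < #{y ∈ ({y | R.Adj (κ (Fin.last q)) y} : Finset Y) |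
      ∀ i : Fin q, R.Adj (κ i.castSucc) y} := by linarith
  obtain ⟨w, hw⟩ := card_pos.1 (Nat.cast_pos.1 h4)
  simp only [mem_filter, mem_univ, true_and] at hw
  refine ⟨κ, w, hκ, hκN, fun i => ?_⟩
  induction i using Fin.lastCases with
  | last => exact hw.1.symm
  | cast i => exact (hw.2 i).symm

end Cliques

section Lattice

variable {α Y A : Type*} [Fintype α] {H : SimpleGraph α} {R : SimpleGraph Y} [AddCommGroup A]
  {φ : Y → A}

theorem eq_zero_of_hcfCompOne (hH : HcfCompOne H) {d : A}
    (hd : ∀ C : H.ConnectedComponent, C.supp.ncard • d = 0) : d = 0 := by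
  have hdvd : ∀ C : H.ConnectedComponent, addOrderOf d ∣ C.supp.ncard := fun C =>
    addOrderOf_dvd_of_nsmul_eq_zero (hd C)
  by_contra hne
  have h1 : addOrderOf d ≠ 1 := fun h => hne (AddMonoid.addOrderOf_eq_one_iff.1 h)
  rcases Nat.eq_zero_or_pos (addOrderOf d) with h0 | h0
  · obtain ⟨C, hC⟩ := hH 2 le_rfl
    have := hdvd C
    rw [h0, zero_dvd_iff] at this
    exact hC (this ▸ dvd_zero 2)
  · obtain ⟨C, hC⟩ := hH _ (show 2 ≤ addOrderOf d by omega)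
    exact hC (hdvd C)

theorem eq_zero_of_hcfChiOne {r : ℕ} (hH : HcfChiOne H r) {d : A}
    (hd : ∀ (c : H.Coloring (Fin r)) (i j : Fin r),
      (({v | c v = i}.ncard : ℤ) - ({v | c v = j}.ncard : ℤ)) • d = 0) : d = 0 := by
  have hdvd := fun c i j => addOrderOf_dvd_iff_zsmul_eq_zero.2 (hd c i j)
  by_contra hne
  have h1 : addOrderOf d ≠ 1 := fun h => hne (AddMonoid.addOrderOf_eq_one_iff.1 h)
  rcases Nat.eq_zero_or_pos (addOrderOf d) with h0 | h0
  · refine hH 2 le_rfl fun c i j => ?_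
    have := hdvd c i j
    rw [h0, Nat.cast_zero, zero_dvd_iff] at this
    exact this ▸ dvd_zero _
  · exact hH _ (show 2 ≤ addOrderOf d by omega) hdvd

theorem two_nsmul_eq_zero_of_hcfChiLeTwo {r : ℕ} (hH : HcfChiLeTwo H r) {d : A}
    (hd : ∀ (c : H.Coloring (Fin r)) (i j : Fin r),
      (({v | c v = i}.ncard : ℤ) - ({v | c v = j}.ncard : ℤ)) • d = 0) : 2 • d = 0 := by
  have hdvd := fun c i j => addOrderOf_dvd_iff_zsmul_eq_zero.2 (hd c i j)
  rw [← addOrderOf_dvd_iff_nsmul_eq_zero]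
  by_cases h3 : 3 ≤ addOrderOf d
  · exact absurd hdvd (hH.2 _ h3)
  · obtain ⟨c, i, j, hij⟩ := hH.1
    have h0 : addOrderOf d ≠ 0 := by
      intro h0
      have := hdvd c i j
      rw [h0, Nat.cast_zero, zero_dvd_iff] at this
      omega
    have : addOrderOf d = 1 ∨ addOrderOf d = 2 := by omega
    rcases this with h | h <;> rw [h]
    exact one_dvd 2

open Finset in
theorem class_sub_zsmul (hφ : ∀ ψ : H →g R, ∑ u, φ (ψ u) = 0) {r : ℕ} {κ : Fin r → Y}
    (hκ : Pairwise fun i j => R.Adj (κ i) (κ j)) (c : H.Coloring (Fin r)) {i j : Fin r}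
    (hij : i ≠ j) :
    (({v | c v = i}.ncard : ℤ) - ({v | c v = j}.ncard : ℤ)) • (φ (κ i) - φ (κ j)) = 0 := by
  have h1 := hφ (homOfClique c κ hκ)
  have h2 := hφ (homOfClique c (κ ∘ Equiv.swap i j)
    fun k l hkl => hκ ((Equiv.swap i j).injective.ne hkl))
  have hcard : ∀ k : Fin r, ({v | c v = k}.ncard : ℤ) = #{v | c v = k} := by
    intro k
    rw [← Set.ncard_coe_finset]
    congr 2
    ext; simp
  have h3 : ∑ u, (φ (κ (c u)) - φ (κ (Equiv.swap i j (c u)))) = 0 := by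
    rw [sum_sub_distrib]
    exact sub_eq_zero.2 (h1.trans h2.symm)
  have h4 : ∀ u, φ (κ (c u)) - φ (κ (Equiv.swap i j (c u))) =
      (if c u = i then φ (κ i) - φ (κ j) else 0) - if c u = j then φ (κ i) - φ (κ j) else 0 := by
    intro u
    by_cases hi : c u = i
    · simp [hi, hij]
    · by_cases hj : c u = j
      · simp [hj, hij.symm]
      · simp [hi, hj, Equiv.swap_apply_of_ne_of_ne hi hj]
  simp_rw [h4, sum_sub_distrib] at h3
  rw [← sum_filter, ← sum_filter, sum_const, sum_const] at h3
  rw [hcard, hcard, sub_zsmul, natCast_zsmul, natCast_zsmul, ← sub_eq_add_neg]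
  exact h3

theorem class_sub_zsmul' (hφ : ∀ ψ : H →g R, ∑ u, φ (ψ u) = 0) {r : ℕ} {κ : Fin r → Y}
    (hκ : Pairwise fun i j => R.Adj (κ i) (κ j)) {i j : Fin r} (hij : i ≠ j)
    (c : H.Coloring (Fin r)) (i' j' : Fin r) :
    (({v | c v = i'}.ncard : ℤ) - ({v | c v = j'}.ncard : ℤ)) • (φ (κ i) - φ (κ j)) = 0 := by
  by_cases h : i' = j'
  · simp [h]
  let π : Equiv.Perm (Fin r) := Equiv.swap (Equiv.swap i' i j') j * Equiv.swap i' i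
  have h1 : π i' = i := by
    simp only [π, Equiv.Perm.mul_apply, Equiv.swap_apply_left]
    refine Equiv.swap_apply_of_ne_of_ne (fun h2 => h ?_) hij
    exact (Equiv.swap i' i).injective ((Equiv.swap_apply_left i' i).trans h2)
  have h2 : π j' = j := by simp [π]
  have := class_sub_zsmul hφ (κ := κ ∘ π) (fun k l hkl => hκ (π.injective.ne hkl)) c h
  simpa [h1, h2] using this

open Finset Classical in
theorem comp_ncard_nsmul (hφ : ∀ ψ : H →g R, ∑ u, φ (ψ u) = 0) {r : ℕ} (c : H.Coloring (Fin r))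
    {κ κ' : Fin r → Y} (hκ : Pairwise fun i j => R.Adj (κ i) (κ j))
    (hκ' : Pairwise fun i j => R.Adj (κ' i) (κ' j)) {d : A} (hd : ∀ i, φ (κ i) - φ (κ' i) = d)
    (C : H.ConnectedComponent) : C.supp.ncard • d = 0 := by
  have h1 := hφ (homOfClique c κ hκ)
  have h2 := hφ ⟨fun u => if u ∈ C.supp then κ' (c u) else κ (c u), by
    intro u v huv
    have hC : u ∈ C.supp ↔ v ∈ C.supp := C.mem_supp_congr_adj huv
    by_cases hu : u ∈ C.supp
    · rw [if_pos hu, if_pos (hC.1 hu)]; exact hκ' (c.valid huv)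
    · rw [if_neg hu, if_neg (hC.not.1 hu)]; exact hκ (c.valid huv)⟩
  have h3 : ∑ u, (if u ∈ C.supp then d else 0) = 0 := by
    have h4 := h1.trans h2.symm
    rw [← sub_eq_zero, ← sum_sub_distrib] at h4
    refine (sum_congr rfl fun u _ => ?_).trans h4
    change _ = φ (κ (c u)) - φ (if u ∈ C.supp then κ' (c u) else κ (c u))
    split_ifs
    · exact (hd _).symm
    · simp
  rw [← sum_filter, sum_const] at h3
  rw [← h3, ← Set.ncard_coe_finset]
  congr 2
  ext; simp

open Finset in
theorem eq_of_common_clique (hφ : ∀ ψ : H →g R, ∑ u, φ (ψ u) = 0) {q : ℕ}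
    (c : H.Coloring (Fin (q + 2))) {v : α} (hv : c v = 0) {κ : Fin (q + 1) → Y}
    (hκ : Pairwise fun i j => R.Adj (κ i) (κ j)) {x x' : Y} (hx : ∀ i, R.Adj x (κ i))
    (hx' : ∀ i, R.Adj x' (κ i)) : φ x = φ x' := by
  classical
  have h1 := hφ (homOfClique c _ (pairwise_adj_cons hκ hx'))
  have h2 := hφ ⟨fun u => if u = v then x else (Fin.cons x' κ : Fin (q + 2) → Y) (c u), by
    have key : ∀ u, H.Adj v u → R.Adj x ((Fin.cons x' κ : Fin (q + 2) → Y) (c u)) := by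
      intro u huv
      have h0 : c u ≠ 0 := fun h => c.valid huv (hv.trans h.symm)
      obtain ⟨j, hj⟩ := Fin.exists_succ_eq.2 h0
      rw [← hj, Fin.cons_succ]
      exact hx j
    intro u w huw
    by_cases hu : u = v
    · subst hu
      rw [if_pos rfl, if_neg huw.ne']
      exact key w huw
    · by_cases hw : w = v
      · subst hw
        rw [if_pos rfl, if_neg hu]
        exact (key u huw.symm).symm
      · rw [if_neg hu, if_neg hw]
        exact pairwise_adj_cons hκ hx' (c.valid huw)⟩
  have h3 := h2.trans h1.symm
  rw [← sub_eq_zero, ← sum_sub_distrib, sum_eq_single v] at h3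
  · change (φ (if v = v then x else _) - φ ((Fin.cons x' κ : Fin (q + 2) → Y) (c v))) = 0 at h3
    rw [if_pos rfl, hv, Fin.cons_zero] at h3
    exact sub_eq_zero.1 h3
  · intro u _ hu
    change (φ (if u = v then x else (Fin.cons x' κ : Fin (q + 2) → Y) (c u)) -
      φ ((Fin.cons x' κ : Fin (q + 2) → Y) (c u))) = 0
    rw [if_neg hu, sub_self]
  · simp

variable [Fintype Y] [Nonempty Y] {q : ℕ} {a ρ η : ℝ}

open Finset Classical in
theorem phi_const_of_rho_one (hφ : ∀ ψ : H →g R, ∑ u, φ (ψ u) = 0) (ha : 0 < a) (hη : 0 < η)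
    (hsum : (q + 1) * a + 1 * a = 1) (hR : DegCond R q a 1 η) (c : H.Coloring (Fin (q + 2)))
    {v : α} (hv : c v = 0) (x x' : Y) : φ x = φ x' := by
  have hM : (0 : ℝ) < Fintype.card Y := Nat.cast_pos.2 Fintype.card_pos
  have hηM : 0 < η * Fintype.card Y := by positivity
  have hbig : ∀ y y', IsBig R a η y → IsBig R a η y' → φ y = φ y' := by
    intro y y' hy hy'
    have h1 := card_add_degN_le R {w | R.Adj y w} y'
    rw [← degN_eq_card] at h1
    unfold IsBig at hy hy'
    obtain ⟨κ, hκ, hκN, -⟩ := hR.exists_clique hsum ha hη.le hη q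
      {w ∈ ({w | R.Adj y w} : Finset Y) | R.Adj y' w} (by nlinarith)
    simp only [mem_filter, mem_univ, true_and] at hκN
    exact eq_of_common_clique hφ c hv hκ (fun i => (hκN i).1) fun i => (hκN i).2
  have hcls : ∀ x, ∃ y, IsBig R a η y ∧ φ x = φ y := by
    intro x0
    obtain ⟨x, hx, hmax⟩ := exists_max_image ({x | φ x0 = φ x} : Finset Y) (fun x => degN R x)
      ⟨x0, by simp⟩
    simp only [mem_filter, mem_univ, true_and] at hx hmax
    have hdx := hR.le_degN ha one_pos x
    obtain ⟨κ, hκ, hκN, hκb⟩ := hR.exists_clique hsum ha hη.le hη q {w | R.Adj x w} (by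
      rw [← degN_eq_card]; exact hdx)
    simp only [mem_filter, mem_univ, true_and] at hκN
    have hW := card_commonNbrs (fun i : Fin q => κ i.castSucc) hη.le hκb {w | R.Adj x w}
    rw [← degN_eq_card] at hW
    set W := {w ∈ ({w | R.Adj x w} : Finset Y) | ∀ i : Fin q, R.Adj (κ i.castSucc) w} with hWdef
    obtain ⟨w, hwW, hw⟩ := hR W (by
      rw [← card_pos]
      have : (0 : ℝ) < #W := by linarith
      exact_mod_cast this)
    have hW' := card_commonNbrs (fun i : Fin q => κ i.castSucc) hη.le hκb {u | R.Adj w u}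
    rw [← degN_eq_card] at hW'
    set W' := {u ∈ ({u | R.Adj w u} : Finset Y) | ∀ i : Fin q, R.Adj (κ i.castSucc) u} with hWdef'
    have hmin : 0 ≤ min (#W : ℝ) (a * Fintype.card Y) := by positivity
    obtain ⟨w', hwW', hw'⟩ := hR W' (by
      rw [← card_pos]
      have : (0 : ℝ) < #W' := by linarith
      exact_mod_cast this)
    simp only [hWdef, hWdef', mem_filter, mem_univ, true_and] at hwW hwW'
    have hclq : Pairwise fun i j => R.Adj
        ((Fin.cons w (fun i : Fin q => κ i.castSucc) : Fin (q + 1) → Y) i)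
        ((Fin.cons w (fun i : Fin q => κ i.castSucc) : Fin (q + 1) → Y) j) :=
      pairwise_adj_cons (fun i j hij => hκ ((Fin.castSucc_injective q).ne hij))
        fun i => (hwW.2 i).symm
    have heq : φ x = φ w' := by
      refine eq_of_common_clique hφ c hv hclq (fun i => ?_) fun i => ?_
      · rcases Fin.eq_zero_or_eq_succ i with rfl | ⟨i, rfl⟩
        · simpa using hwW.1
        · simpa using hκN _
      · rcases Fin.eq_zero_or_eq_succ i with rfl | ⟨i, rfl⟩
        · simpa using hwW'.1.symm
        · simpa using (hwW'.2 _).symm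
    refine ⟨w', ?_, hx.trans heq⟩
    have h1 : (degN R w' : ℝ) ≤ degN R x := by exact_mod_cast hmax w' (hx.trans heq)
    unfold IsBig
    rcases le_total (#W : ℝ) (a * Fintype.card Y) with h2 | h2 <;>
      rcases le_total (#W' : ℝ) (a * Fintype.card Y) with h3 | h3
    · rw [min_eq_left h2] at hw
      rw [min_eq_left h3] at hw'
      linarith
    · rw [min_eq_right h3] at hw'
      nlinarith
    · rw [min_eq_right h2] at hw
      linarith
    · rw [min_eq_right h3] at hw'
      nlinarith
  obtain ⟨y, hy, hxy⟩ := hcls x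
  obtain ⟨y', hy', hxy'⟩ := hcls x'
  rw [hxy, hxy', hbig y y' hy hy']

open Finset Classical in
theorem phi_const_of_hcfOne (hφ : ∀ ψ : H →g R, ∑ u, φ (ψ u) = 0) (ha : 0 < a) (hρ : 0 < ρ)
    (hη : 0 < η) (hsum : (q + 1) * a + ρ * a = 1) (hR : DegCond R q a ρ η)
    (c : H.Coloring (Fin (q + 2))) (hH : HcfOne H (q + 2)) (x x' : Y) : φ x = φ x' := by
  have hM : (0 : ℝ) < Fintype.card Y := Nat.cast_pos.2 Fintype.card_pos
  have hηM : 0 < η * Fintype.card Y := by positivity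
  rcases q with _ | q
  · obtain ⟨hcomp, hchi⟩ := hH.1 rfl
    have hnbr : ∀ y, ∃ z, R.Adj y z := by
      intro y
      have h1 := hR.le_degN ha hρ y
      rw [degN_eq_card] at h1
      have h2 : (0 : ℝ) < #{w | R.Adj y w} := by
        push_cast at h1
        linarith
      obtain ⟨z, hz⟩ := card_pos.1 (Nat.cast_pos.1 h2)
      exact ⟨z, by simpa using hz⟩
    have hclq : ∀ {y z}, R.Adj y z → Pairwise fun i j : Fin 2 => R.Adj (![y, z] i) (![y, z] j) := by
      intro y z hyz i j hij
      fin_cases i <;> fin_cases j <;> first | exact absurd rfl hij | simpa using hyz |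
        simpa using hyz.symm
    have hedge : ∀ y z, R.Adj y z → φ y = φ z := by
      intro y z hyz
      have h2 : 2 • (φ y - φ z) = 0 := two_nsmul_eq_zero_of_hcfChiLeTwo hchi
        (class_sub_zsmul' hφ (hclq hyz) zero_ne_one)
      refine sub_eq_zero.1 (eq_zero_of_hcfCompOne hcomp
        (comp_ncard_nsmul hφ c (hclq hyz) (hclq hyz.symm) fun i => ?_))
      fin_cases i
      · simp
      · rw [two_nsmul] at h2
        simpa using (eq_neg_of_add_eq_zero_left h2).symm
    obtain ⟨z, hz⟩ := hnbr x
    obtain ⟨z', hz'⟩ := hnbr x'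
    refine sub_eq_zero.1 (eq_zero_of_hcfCompOne hcomp
      (comp_ncard_nsmul hφ c (hclq hz) (hclq hz') fun i => ?_))
    fin_cases i
    · simp
    · simp [← hedge _ _ hz, ← hedge _ _ hz']
  · have hchi := hH.2 (by omega)
    push_cast at hsum
    have hbigadj : ∀ z y, R.Adj z y → IsBig R a η y → φ z = φ y := by
      intro z y hzy hy
      have h1 := hR.le_degN ha hρ z
      have h2 := hy.card_filter hη.le {w | R.Adj z w}
      rw [← degN_eq_card] at h2
      push_cast at h1
      obtain ⟨κ, hκ, hκN, -⟩ := hR.exists_clique (by push_cast; linarith) ha hη.le hη q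
        {w ∈ ({w | R.Adj z w} : Finset Y) | R.Adj y w} (by linarith)
      simp only [mem_filter, mem_univ, true_and] at hκN
      have hc := pairwise_adj_cons (pairwise_adj_cons hκ fun i => (hκN i).2) (x := z) fun i => by
        rcases Fin.eq_zero_or_eq_succ i with rfl | ⟨i, rfl⟩
        · simpa using hzy
        · simpa using (hκN i).1
      have h3 := eq_zero_of_hcfChiOne hchi
        (class_sub_zsmul' hφ hc (i := 0) (j := 1) (by simp))
      simpa [sub_eq_zero] using h3
    have hbig : ∀ y y', IsBig R a η y → IsBig R a η y' → φ y = φ y' := by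
      intro y y' hy hy'
      have h1 := hy'.card_filter hη.le {w | R.Adj y w}
      rw [← degN_eq_card] at h1
      unfold IsBig at hy
      have h2 : (0 : ℝ) < #{w ∈ ({w | R.Adj y w} : Finset Y) | R.Adj y' w} := by
        have : 2 * a ≤ 1 := by nlinarith [mul_pos hρ ha, mul_nonneg (Nat.cast_nonneg (α := ℝ) q) ha.le]
        nlinarith
      obtain ⟨z, hz⟩ := card_pos.1 (Nat.cast_pos.1 h2)
      simp only [mem_filter, mem_univ, true_and] at hz
      rw [← hbigadj z y hz.1.symm hy, ← hbigadj z y' hz.2.symm hy']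
    have hcls : ∀ x, ∃ y, IsBig R a η y ∧ φ x = φ y := by
      intro x
      obtain ⟨κ, -, hκN, hκb⟩ := hR.exists_clique (by push_cast; linarith) ha hη.le hη (q + 1)
        {w | R.Adj x w} (by rw [← degN_eq_card]; exact hR.le_degN ha hρ x)
      have h1 := hκN (0 : Fin (q + 1)).castSucc
      simp only [mem_filter, mem_univ, true_and] at h1
      exact ⟨_, hκb 0, hbigadj _ _ h1 (hκb 0)⟩
    obtain ⟨y, hy, hxy⟩ := hcls x
    obtain ⟨y', hy', hxy'⟩ := hcls x'
    rw [hxy, hxy', hbig y y' hy hy']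

end Lattice

section Integer

variable {Ψ Y : Type*} [Fintype Ψ] [Fintype Y]

open Finset in
/-- If every weighting of `Y` annihilated by all `g ψ` is constant, then the `g ψ` generate all
integer vectors with sum divisible by `h`. -/
theorem exists_int_combination (g : Ψ → Y → ℤ) (h : ℤ) (hg : ∀ ψ, ∑ y, g ψ y = h) [Nonempty Ψ]
    (hconst : ∀ φ : Y → (Y → ℤ) ⧸ Submodule.span ℤ (Set.range g),
      (∀ ψ, ∑ y, g ψ y • φ y = 0) → ∀ y y', φ y = φ y')
    (v : Y → ℤ) (hv : h ∣ ∑ y, v y) : ∃ n : Ψ → ℤ, ∀ y, ∑ ψ, n ψ * g ψ y = v y := by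
  classical
  let S := Submodule.span ℤ (Set.range g)
  let φ : Y → (Y → ℤ) ⧸ S := fun y => S.mkQ (Pi.single y 1)
  have hmk : ∀ u : Y → ℤ, ∑ y, u y • φ y = S.mkQ u := by
    intro u
    simp only [φ, ← map_smul, ← map_sum]
    congr 1
    funext y
    simp [Finset.sum_apply, Pi.single_apply]
  have hzero : ∀ ψ, ∑ y, g ψ y • φ y = 0 := by
    intro ψ
    rw [hmk]
    exact (Submodule.Quotient.mk_eq_zero S).2 (Submodule.subset_span ⟨ψ, rfl⟩)
  have hφ := hconst φ hzero
  have hvS : S.mkQ v = 0 := by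
    rw [← hmk]
    rcases isEmpty_or_nonempty Y with hY | ⟨⟨y0⟩⟩
    · simp
    · obtain ⟨ψ⟩ := ‹Nonempty Ψ›
      have h1 := hzero ψ
      simp only [hφ _ y0, ← sum_smul, hg] at h1 ⊢
      obtain ⟨k, hk⟩ := hv
      rw [hk, mul_comm, mul_smul, h1, smul_zero]
  obtain ⟨n, hn⟩ := (Submodule.mem_span_range_iff_exists_fun ℤ).1
    ((Submodule.Quotient.mk_eq_zero S).1 hvS)
  refine ⟨n, fun y => ?_⟩
  rw [← hn]
  simp [Finset.sum_apply]

open Finset in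
theorem exists_nat_combination (g : Ψ → Y → ℤ) (h : ℤ) (hg : ∀ ψ, ∑ y, g ψ y = h) (c : Ψ → ℝ)
    (hc : ∀ ψ, 0 < c ψ) (hcg : ∀ y, ∑ ψ, c ψ * g ψ y = 1)
    (hspan : ∀ v : Y → ℤ, h ∣ ∑ y, v y → ∃ n : Ψ → ℤ, ∀ y, ∑ ψ, n ψ * g ψ y = v y) (B : ℕ) :
    ∃ t₀ : ℕ, ∀ t ≥ t₀, ∀ v : Y → ℤ, (∀ y, |v y - t| ≤ B) → h ∣ ∑ y, v y →
      ∃ n : Ψ → ℕ, ∀ y, ∑ ψ, n ψ * g ψ y = v y := by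
  classical
  choose n hn using hspan
  let n' : (Y → ℤ) → Ψ → ℤ := fun v => if hv : h ∣ ∑ y, v y then n v hv else 0
  let G : Y → ℤ := fun y => ∑ ψ, |g ψ y|
  let F : Finset (Y → ℤ) := Fintype.piFinset fun y => Icc (-(B + G y)) (B + G y)
  let L : ℤ := ∑ d ∈ F, ∑ ψ, |n' d ψ|
  refine ⟨∑ ψ, ⌈((L : ℝ) + 1) / c ψ⌉₊, fun t ht v hvt hv => ?_⟩
  have hfloor : ∀ ψ, L ≤ ⌊t * c ψ⌋ := by
    intro ψ
    rw [Int.le_floor]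
    have h1 : ⌈((L : ℝ) + 1) / c ψ⌉₊ ≤ t :=
      (single_le_sum (f := fun ψ => ⌈((L : ℝ) + 1) / c ψ⌉₊) (fun _ _ => Nat.zero_le _)
        (mem_univ ψ)).trans ht
    have h2 : ((L : ℝ) + 1) / c ψ ≤ t := (Nat.le_ceil _).trans (Nat.cast_le.2 h1)
    rw [div_le_iff₀ (hc ψ)] at h2
    linarith
  set d : Y → ℤ := fun y => v y - ∑ ψ, ⌊t * c ψ⌋ * g ψ y with hd
  have hdsum : h ∣ ∑ y, d y := by
    simp only [hd, sum_sub_distrib]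
    rw [sum_comm]
    simp_rw [← mul_sum, hg, ← sum_mul]
    exact dvd_sub hv (dvd_mul_left _ _)
  have hdF : d ∈ F := by
    rw [Fintype.mem_piFinset]
    intro y
    rw [mem_Icc, ← abs_le, ← Int.cast_le (R := ℝ)]
    have h1 : ((d y : ℤ) : ℝ) = ((v y - t : ℤ) : ℝ) + ∑ ψ, Int.fract (t * c ψ) * g ψ y := by
      simp only [hd, Int.fract, sub_mul, sum_sub_distrib, mul_assoc, ← mul_sum, hcg]
      push_cast
      ring
    have h2 : |∑ ψ, Int.fract (t * c ψ) * (g ψ y : ℝ)| ≤ G y := by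
      refine (abs_sum_le_sum_abs _ _).trans ?_
      simp only [G]
      push_cast
      refine sum_le_sum fun ψ _ => ?_
      rw [abs_mul, abs_of_nonneg (Int.fract_nonneg _)]
      exact mul_le_of_le_one_left (abs_nonneg _) (Int.fract_lt_one _).le
    have h3 : |((v y - t : ℤ) : ℝ)| ≤ B := by exact_mod_cast hvt y
    push_cast at h1 h3 ⊢
    rw [h1]
    exact (abs_add_le _ _).trans (add_le_add h3 h2)
  have hbound : ∀ ψ, |n' d ψ| ≤ L := fun ψ =>
    (single_le_sum (f := fun ψ => |n' d ψ|) (fun _ _ => abs_nonneg _) (mem_univ ψ)).trans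
      (single_le_sum (f := fun d => ∑ ψ, |n' d ψ|)
        (fun _ _ => sum_nonneg fun _ _ => abs_nonneg _) hdF)
  refine ⟨fun ψ => (⌊t * c ψ⌋ + n' d ψ).toNat, fun y => ?_⟩
  have h1 : ∀ ψ, (((⌊t * c ψ⌋ + n' d ψ).toNat : ℕ) : ℤ) = ⌊t * c ψ⌋ + n' d ψ := by
    intro ψ
    apply Int.toNat_of_nonneg
    have := neg_abs_le (n' d ψ)
    have := hbound ψ
    have := hfloor ψ
    linarith
  have h2 : ∑ ψ, n' d ψ * g ψ y = d y := by
    simp only [n', dif_pos hdsum]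
    exact hn d hdsum y
  simp only [h1, add_mul, sum_add_distrib, h2]
  simp [hd]

end Integer

/-- The properties of `H` and of the parameters `a` and `ρ` which the tiling argument uses. -/
structure IsTilingParam {α : Type*} [Fintype α] (H : SimpleGraph α) (q : ℕ) (a ρ : ℝ) : Prop where
  a_pos : 0 < a
  ρ_pos : 0 < ρ
  ρ_le : ρ ≤ 1
  sum_eq : (q + 1) * a + ρ * a = 1
  exists_averaging : ∃ (c : H.Coloring (Fin (q + 2))) (P : Finset (Equiv.Perm (Fin (q + 2)))),
    IsBottleAveraging a ρ c P
  surjective : ∀ c : H.Coloring (Fin (q + 2)), Function.Surjective c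
  hcf : HcfOne H (q + 2) ∨ ρ = 1

universe u v

section Local

variable {α : Type*} [Fintype α] {H : SimpleGraph α} {q : ℕ} {a ρ η : ℝ}

theorem IsTilingParam.card_pos (hH : IsTilingParam H q a ρ) : 0 < Fintype.card α := by
  obtain ⟨c, -⟩ := hH.exists_averaging
  obtain ⟨v, -⟩ := hH.surjective c 0
  exact Fintype.card_pos_iff.2 ⟨v⟩

open Finset in
theorem sum_comp_eq_sum_homVec {Y A : Type*} [Fintype Y] [DecidableEq Y] [AddCommGroup A]
    (φ : Y → A) (ψ : α → Y) : ∑ u, φ (ψ u) = ∑ y, (homVec ψ y : ℤ) • φ y := by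
  rw [← sum_fiberwise univ ψ]
  refine sum_congr rfl fun y _ => ?_
  rw [natCast_zsmul, homVec, ← sum_const]
  exact sum_congr rfl fun u hu => by rw [(mem_filter.1 hu).2]

open Finset in
theorem IsTilingParam.exists_hom_combination {Y : Type*} [Fintype Y] [DecidableEq Y] [Nonempty Y]
    {R : SimpleGraph Y} [Fintype (H →g R)] (hH : IsTilingParam H q a ρ) (hη : 0 < η)
    (hR : DegCond R q a ρ η) (B : ℕ) :
    ∃ t₀ : ℕ, ∀ t ≥ t₀, ∀ v : Y → ℤ, (∀ y, |v y - t| ≤ B) → (Fintype.card α : ℤ) ∣ ∑ y, v y →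
      ∃ n : (H →g R) → ℕ, ∀ y, ∑ ψ, (n ψ : ℤ) * homVec ψ y = v y := by
  obtain ⟨c, P, hP⟩ := hH.exists_averaging
  obtain ⟨v, hv⟩ := hH.surjective c 0
  obtain ⟨w, hw0, hw⟩ := exists_pos_hom_weights hH.a_pos hH.ρ_pos hH.ρ_le hH.sum_eq hη hR
    hH.card_pos hP
  have hsum : ∀ ψ : H →g R, ∑ y, (homVec ψ y : ℤ) = Fintype.card α := fun ψ => by
    exact_mod_cast sum_homVec ψ
  have : Nonempty (H →g R) := by
    by_contra h
    rw [not_nonempty_iff] at h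
    have := hw (Classical.arbitrary Y)
    simp at this
  refine exists_nat_combination (fun (ψ : H →g R) y => (homVec ψ y : ℤ)) _ hsum w hw0
    (by exact_mod_cast hw) (fun u hu => exists_int_combination _ _ hsum (fun φ hφ y y' => ?_) u hu) B
  have hφ' : ∀ ψ : H →g R, ∑ u, φ (ψ u) = 0 := fun ψ => by
    rw [sum_comp_eq_sum_homVec]; exact hφ ψ
  rcases hH.hcf with h | rfl
  · exact phi_const_of_hcfOne hφ' hH.a_pos hH.ρ_pos hη hH.sum_eq hR c h y y'
  · exact phi_const_of_rho_one hφ' hH.a_pos hη hH.sum_eq hR c hv y y'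

/-- The class to which an element of a blow-up belongs. -/
def blowClass {ι α : Type*} {t : ℕ} (p : Option (ι × Fin t) × α) : Option ι × α :=
  (p.1.map Prod.fst, p.2)

/-- The type of a sample is good if the sample satisfies the degree condition and sees enough of
the exceptional piece. -/
def IsGoodType {ι : Type*} [Fintype ι] (q : ℕ) (a ρ η : ℝ) (R : SimpleGraph (Option ι × α)) :
    Prop :=
  DegCond (R.comap fun y : ι × α => (some y.1, y.2)) q a ρ η ∧
    ∀ b, (q * a + η) * Fintype.card (ι × α) ≤ {y : ι × α | R.Adj (none, b) (some y.1, y.2)}.ncard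

open Finset in
theorem card_fiber_prod {K Z : Type*} [Fintype K] [DecidableEq Z] (Ψ : K → α → Z) (z : Z) :
    Fintype.card {p : K × α // Ψ p.1 p.2 = z} = ∑ k, homVec (Ψ k) z := by
  rw [Fintype.card_subtype, card_filter, Fintype.sum_prod_type]
  simp [homVec]

open Finset in
theorem exists_hom_none {ι : Type*} [Fintype ι] [DecidableEq ι] [DecidableEq α] [Nonempty ι]
    (hH : IsTilingParam H q a ρ) (hη : 0 < η) {R : SimpleGraph (Option ι × α)}
    (hR : IsGoodType q a ρ η R) (b : α) :
    ∃ ψ : H →g R, (∀ b', homVec ψ (none, b') = if b = b' then 1 else 0) ∧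
      ∑ y : ι × α, homVec ψ (some y.1, y.2) = Fintype.card α - 1 := by
  classical
  have : Nonempty α := ⟨b⟩
  obtain ⟨c, P, hP⟩ := hH.exists_averaging
  obtain ⟨v, hv⟩ := hH.surjective c 0
  have hN := hR.2 b
  set R' := R.comap fun y : ι × α => (some y.1, y.2)
  obtain ⟨κ, w, hκ, hκN, hw⟩ := DegCond.exists_clique_nbr hR.1 hH.sum_eq hH.a_pos hH.ρ_pos hη hη
    {y : ι × α | R.Adj (none, b) (some y.1, y.2)} (by
      convert hN using 2
      rw [← Set.ncard_coe_finset]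
      congr 1
      ext; simp)
  simp only [mem_filter, mem_univ, true_and] at hκN
  set κ' : Fin (q + 2) → ι × α := Fin.cons w κ with hκ'
  let f : α → Option ι × α := fun u =>
    if u = v then (none, b) else (some (κ' (c u)).1, (κ' (c u)).2)
  have key : ∀ u, H.Adj v u → R.Adj (none, b) (some (κ' (c u)).1, (κ' (c u)).2) := by
    intro u hu
    have h0 : c u ≠ 0 := fun h => c.valid hu (hv.trans h.symm)
    obtain ⟨j, hj⟩ := Fin.exists_succ_eq.2 h0
    rw [← hj, hκ', Fin.cons_succ]
    exact hκN j
  let ψ : H →g R := ⟨f, by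
    intro u u' huu
    simp only [f]
    by_cases hu : u = v
    · subst hu
      rw [if_pos rfl, if_neg huu.ne']
      exact key _ huu
    · by_cases hu' : u' = v
      · subst hu'
        rw [if_pos rfl, if_neg hu]
        exact (key _ huu.symm).symm
      · rw [if_neg hu, if_neg hu']
        exact pairwise_adj_cons (R := R') hκ hw (c.valid huu)⟩
  have h1 : ∀ b', homVec ψ (none, b') = if b = b' then 1 else 0 := by
    intro b'
    have h2 : ∀ u, ψ u = (none, b') ↔ u = v ∧ b = b' := by
      intro u
      change f u = _ ↔ _
      simp only [f]
      split_ifs with h <;> simp [h]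
    simp only [homVec, h2]
    split_ifs with h
    · simp only [h, and_true]
      exact card_eq_one.2 ⟨v, by ext; simp⟩
    · simp [h]
  refine ⟨ψ, h1, ?_⟩
  have h3 := sum_homVec ψ
  rw [Fintype.sum_prod_type, Fintype.sum_option] at h3
  simp only [h1, sum_ite_eq, mem_univ, if_true] at h3
  rw [Fintype.sum_prod_type]
  simp only
  omega

open Finset in
theorem exists_local_family {ι : Type u} {α : Type v} [Fintype α] {H : SimpleGraph α}
    [Fintype ι] [DecidableEq ι] [DecidableEq α] [Nonempty ι]
    (hH : IsTilingParam H q a ρ) (hη : 0 < η) {R : SimpleGraph (Option ι × α)}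
    (hR : IsGoodType q a ρ η R) :
    ∃ t₀ : ℕ, ∀ t ≥ t₀, ∃ (K : Type (max u v)) (_ : Fintype K) (Ψ : K → (H →g R)), ∀ o b,
      ∑ k, homVec (Ψ k) (o, b) = o.elim 1 fun _ => t := by
  classical
  have : Nonempty α := Fintype.card_pos_iff.1 hH.card_pos
  have hfin : Finite (H →g R.comap fun y : ι × α => (some y.1, y.2)) := DFunLike.finite _
  have := Fintype.ofFinite (H →g R.comap fun y : ι × α => (some y.1, y.2))
  choose ψ hψ1 hψ2 using exists_hom_none hH hη hR
  obtain ⟨t₀, ht₀⟩ := hH.exists_hom_combination hη hR.1 (Fintype.card α * Fintype.card α)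
  refine ⟨t₀, fun t ht => ?_⟩
  obtain ⟨n, hn⟩ := ht₀ t ht (fun y => t - ∑ b, (homVec (ψ b) (some y.1, y.2) : ℤ))
    (fun y => by
      rw [sub_sub_cancel_left, abs_neg, abs_of_nonneg (by positivity)]
      have : ∑ b, homVec (ψ b) (some y.1, y.2) ≤ ∑ b : α, Fintype.card α :=
        sum_le_sum fun b _ => card_le_univ _
      simp only [sum_const, card_univ, smul_eq_mul] at this
      exact_mod_cast this)
    (by
      rw [sum_sub_distrib, sum_comm]
      have : ∀ b, ∑ y : ι × α, (homVec (ψ b) (some y.1, y.2) : ℤ) = Fintype.card α - 1 := by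
        intro b
        have := hψ2 b
        have h1 : 1 ≤ Fintype.card α := hH.card_pos
        zify [h1] at this
        exact this
      simp only [this, sum_const, card_univ, nsmul_eq_mul, Fintype.card_prod]
      refine dvd_sub ⟨Fintype.card ι * t, by push_cast; ring⟩ (dvd_mul_right _ _))
  obtain ⟨lift, hlift⟩ : ∃ lift : (H →g R.comap fun y : ι × α => (some y.1, y.2)) → (H →g R),
      ∀ k u, lift k u = (some (k u).1, (k u).2) :=
    ⟨fun k => ⟨fun u => (some (k u).1, (k u).2), fun h => k.map_rel h⟩, fun _ _ => rfl⟩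
  refine ⟨((ψ' : H →g R.comap fun y : ι × α => (some y.1, y.2)) × Fin (n ψ')) ⊕ α, inferInstance,
    Sum.elim (fun k => lift k.1) ψ, ?_⟩
  intro o b
  rw [Fintype.sum_sum_type, Fintype.sum_sigma]
  rcases o with _ | i
  · have : ∀ k, homVec (lift k) (none, b) = 0 := fun k => by simp [homVec, hlift]
    simp [hψ1, this]
  · have : ∀ k, homVec (lift k) (some i, b) = homVec k (i, b) := fun k => by
      simp [homVec, hlift, Prod.ext_iff]
    have h1 := hn (i, b)
    simp only [Sum.elim_inl, Sum.elim_inr, this, sum_const, card_univ,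
      Fintype.card_fin, smul_eq_mul, Option.elim_some]
    simp only at h1
    zify
    rw [h1, sub_add_cancel]

open Finset in
/-- A blow-up of a good type, with its exceptional piece, can be rearranged into copies of `H`. -/
theorem exists_local_rearrangement {ι : Type u} {α : Type v} [Fintype α] {H : SimpleGraph α}
    [Fintype ι] [Nonempty ι] (hH : IsTilingParam H q a ρ) (hη : 0 < η)
    {R : SimpleGraph (Option ι × α)} (hR : IsGoodType q a ρ η R) :
    ∃ t₀ : ℕ, ∀ t ≥ t₀, ∃ e : Equiv.Perm (Option (ι × Fin t) × α), ∀ j, ∃ ψ : H →g R,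
      ∀ u, blowClass (e (j, u)) = ψ u := by
  classical
  obtain ⟨t₀, ht₀⟩ := exists_local_family hH hη hR
  refine ⟨t₀, fun t ht => ?_⟩
  obtain ⟨K, _, Ψ, hΨ⟩ := ht₀ t ht
  have hcl : ∀ z : Option ι × α,
      Fintype.card {p : Option (ι × Fin t) × α // blowClass p = z} = z.1.elim 1 fun _ => t := by
    rintro ⟨o, b⟩
    rw [Fintype.card_subtype, card_filter, Fintype.sum_prod_type, Fintype.sum_option,
      Fintype.sum_prod_type]
    rcases o with _ | i
    · simp [blowClass]
    · simp [blowClass, ite_and]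
  have hfib : ∀ z, Nonempty ({p : K × α // Ψ p.1 p.2 = z} ≃
      {p : Option (ι × Fin t) × α // blowClass p = z}) := by
    intro z
    refine ⟨Fintype.equivOfCardEq ?_⟩
    rw [hcl, card_fiber_prod (fun k => Ψ k)]
    exact hΨ z.1 z.2
  let E : K × α ≃ Option (ι × Fin t) × α := Equiv.ofFiberEquiv fun z => (hfib z).some
  have hE : ∀ p, blowClass (E p) = Ψ p.1 p.2 := fun p => Equiv.ofFiberEquiv_map _ p
  have hcard : Fintype.card (Option (ι × Fin t)) = Fintype.card K := by
    have h1 := Fintype.card_congr E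
    rw [Fintype.card_prod, Fintype.card_prod] at h1
    exact (Nat.eq_of_mul_eq_mul_right hH.card_pos h1).symm
  let θ := Fintype.equivOfCardEq hcard
  exact ⟨(θ.prodCongr (Equiv.refl α)).trans E, fun j => ⟨Ψ (θ j), fun u => hE (θ j, u)⟩⟩

end Local

section Box

variable {X : Type*} [Fintype X] [DecidableEq X]

open Finset in
/-- A dense relation between two types contains many complete stars with `t` centres. -/
theorem exists_dense_common (t : ℕ) {c : ℝ} (hc : 0 < c) {Z : Type*} [Fintype Z]
    (htN : t ≤ Fintype.card X) (hX : 4 * t ≤ c * Fintype.card X) (hX0 : 0 < Fintype.card X) (r : X → Z → Prop)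
    [∀ x z, Decidable (r x z)]
    (hr : c * (Fintype.card X * Fintype.card Z) ≤ ∑ z, (#{x | r x z} : ℝ)) :
    ∃ A : Finset X, #A = t ∧ c / 2 * (c / 4) ^ t * Fintype.card Z ≤ #{z | ∀ x ∈ A, r x z} := by
  classical
  set N : ℝ := (Fintype.card X : ℝ) with hN
  have hN0 : 0 < N := Nat.cast_pos.2 hX0
  set Q : Finset Z := {z | c * N / 2 ≤ #{x | r x z}} with hQ
  have hQcard : c / 2 * Fintype.card Z ≤ #Q := by
    have h1 : ∑ z, (#{x | r x z} : ℝ) ≤ ∑ z : Z, (c * N / 2 + if z ∈ Q then N else 0) := by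
      refine sum_le_sum fun z _ => ?_
      have h2 : (#{x | r x z} : ℝ) ≤ N := Nat.cast_le.2 (card_le_univ _)
      split_ifs with h
      · nlinarith
      · rw [hQ, mem_filter, not_and, not_le] at h
        linarith [h (mem_univ _)]
    rw [sum_add_distrib, sum_const, card_univ, nsmul_eq_mul, ← sum_filter, filter_mem_eq_inter,
      univ_inter, sum_const, nsmul_eq_mul] at h1
    have h3 : N * (c / 2 * Fintype.card Z) ≤ N * #Q := by linarith
    exact le_of_mul_le_mul_left h3 hN0
  have hstar : ∀ z ∈ Q, (c / 4) ^ t * N ^ t ≤ t.factorial * (#{x | r x z}).choose t := by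
    intro z hz
    rw [hQ, mem_filter] at hz
    have h4 := hz.2
    rw [← mul_pow]
    have h10 := (Nat.pow_sub_le_descFactorial #{x | r x z} t).trans_eq
      (Nat.descFactorial_eq_factorial_mul_choose _ _)
    refine le_trans ?_ (by exact_mod_cast h10 :
      (((#{x | r x z} + 1 - t) ^ t : ℕ) : ℝ) ≤ t.factorial * (#{x | r x z}).choose t)
    rw [Nat.cast_pow]
    refine pow_le_pow_left₀ (by positivity) ?_ t
    have : (#{x | r x z} : ℝ) ≤ ((#{x | r x z} + 1 - t : ℕ) : ℝ) + t := by
      norm_cast; omega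
    linarith
  have hdouble : ∑ A ∈ powersetCard t (univ : Finset X), #{z | ∀ x ∈ A, r x z} =
      ∑ z : Z, (#{x | r x z}).choose t := by
    simp only [card_filter]
    rw [sum_comm]
    refine sum_congr rfl fun z _ => ?_
    rw [← card_filter, ← card_filter, ← card_powersetCard]
    congr 1
    ext A
    simp only [mem_filter, mem_powersetCard, true_and, subset_iff, mem_univ]
    tauto
  by_contra! hcon
  have hlt : (∑ z : Z, (#{x | r x z}).choose t : ℝ) <
      (Fintype.card X).choose t * (c / 2 * (c / 4) ^ t * Fintype.card Z) := by
    rw [← card_univ, ← card_powersetCard, ← nsmul_eq_mul, ← sum_const]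
    have h5 := sum_lt_sum_of_nonempty (powersetCard_nonempty.2 (htN.trans_eq card_univ.symm))
      fun A hA => hcon A (mem_powersetCard.1 hA).2
    refine lt_of_eq_of_lt ?_ h5
    exact_mod_cast hdouble.symm
  have hch : (t.factorial * (Fintype.card X).choose t : ℝ) ≤ N ^ t := by
    have := (Nat.descFactorial_eq_factorial_mul_choose (Fintype.card X) t).symm.trans_le
      (Nat.descFactorial_le_pow _ _)
    rw [hN]
    exact_mod_cast this
  have h6 : #Q * ((c / 4) ^ t * N ^ t) ≤ t.factorial * ∑ z : Z, ((#{x | r x z}).choose t : ℝ) := by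
    rw [mul_sum, ← nsmul_eq_mul]
    exact (card_nsmul_le_sum _ _ _ hstar).trans
      (sum_le_sum_of_subset_of_nonneg (subset_univ _) fun _ _ _ => by positivity)
  have h7 := mul_le_mul_of_nonneg_right hQcard (by positivity : 0 ≤ (c / 4) ^ t * N ^ t)
  have h8 := mul_lt_mul_of_pos_left hlt (by positivity : (0 : ℝ) < t.factorial)
  have h9 := mul_le_mul_of_nonneg_right hch
    (by positivity : 0 ≤ c / 2 * (c / 4) ^ t * Fintype.card Z)
  nlinarith

open Finset in
/-- Dense families of `m`-tuples contain boxes of any fixed size. -/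
theorem exists_box (m t : ℕ) {c : ℝ} (hc : 0 < c) :
    ∃ N₀ : ℕ, ∀ (X : Type*) [Fintype X] [DecidableEq X], N₀ ≤ Fintype.card X →
      ∀ S : Finset (Fin m → X), c * (Fintype.card X : ℝ) ^ m ≤ #S →
        ∃ T : Fin m → Finset X, (∀ i, #(T i) = t) ∧ ∀ p, (∀ i, p i ∈ T i) → p ∈ S := by
  induction m generalizing c with
  | zero =>
    refine ⟨0, fun X _ _ _ S hS => ⟨finZeroElim, finZeroElim, fun p _ => ?_⟩⟩
    have hpos : (0 : ℝ) < #S := by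
      rw [pow_zero, mul_one] at hS
      linarith
    obtain ⟨p', hp'⟩ := card_pos.1 (by exact_mod_cast hpos : 0 < #S)
    rwa [Subsingleton.elim p p']
  | succ m ih =>
    obtain ⟨N₀, hN₀⟩ := ih (by positivity : 0 < c / 2 * (c / 4) ^ t)
    obtain ⟨N₁, hN₁⟩ := exists_nat_ge (4 * t / c)
    refine ⟨max N₀ (max N₁ (t + 1)), fun X _ _ hX S hS => ?_⟩
    simp only [max_le_iff] at hX
    have hX1 : (4 * t / c : ℝ) ≤ Fintype.card X := hN₁.trans (by exact_mod_cast hX.2.1)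
    have hSsum : ∑ z : Fin m → X, #{x | (Fin.cons x z : Fin (m + 1) → X) ∈ S} = #S := by
      simp only [card_filter]
      rw [sum_comm, ← Fintype.sum_prod_type' (f := fun (x : X) (z : Fin m → X) =>
        if (Fin.cons x z : Fin (m + 1) → X) ∈ S then 1 else 0)]
      refine (Fintype.sum_equiv (Fin.consEquiv fun _ => X) _ (fun p => if p ∈ S then 1 else 0)
        fun _ => rfl).trans ?_
      simp
    obtain ⟨A, hA, hAS⟩ := exists_dense_common t hc (Z := Fin m → X) (by omega)
      (by rw [div_le_iff₀ hc] at hX1; linarith) (by omega)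
      (fun x z => (Fin.cons x z : Fin (m + 1) → X) ∈ S) (by
        refine le_trans (le_of_eq ?_) (hS.trans_eq (by exact_mod_cast hSsum.symm))
        simp [pow_succ, mul_comm])
    obtain ⟨T, hT, hTS⟩ := hN₀ X hX.1 _ (by simpa using hAS)
    refine ⟨Fin.cons A T, fun i => ?_, fun p hp => ?_⟩
    · refine Fin.cases ?_ (fun j => ?_) i
      · simpa using hA
      · simpa using hT j
    · have h1 := hTS (Fin.tail p) fun i => by simpa [Fin.tail] using hp i.succ
      have h2 := (mem_filter.1 h1).2 (p 0) (by simpa using hp 0)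
      rwa [Fin.cons_self_tail] at h2

end Box

section Sampling

variable {X : Type*} [Fintype X] {m : ℕ}

open Finset in
/-- An exponential lower tail bound for sums of independent samples. -/
theorem card_lower_tail_le {g : X → ℝ} (hg0 : ∀ x, 0 ≤ g x) (hg1 : ∀ x, g x ≤ 1) {μ ε : ℝ}
    (hμ : ∑ x, g x = Fintype.card X * μ) (hμ0 : 0 ≤ μ) (hμ1 : μ ≤ 1) (hε : 0 ≤ ε) (hε2 : ε ≤ 2) :
    (#{p : Fin m → X | ∑ j, g (p j) ≤ m * (μ - ε)} : ℝ) ≤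
      (Fintype.card X : ℝ) ^ m * Real.exp (-(ε ^ 2 / 4 * m)) := by
  classical
  set N : ℝ := (Fintype.card X : ℝ) with hN
  have hprod : ∑ p : Fin m → X, ∏ j, Real.exp (-(ε / 2) * (g (p j) - μ)) =
      (∑ x, Real.exp (-(ε / 2) * (g x - μ))) ^ m := by
    have := (prod_univ_sum (fun _ : Fin m => (univ : Finset X))
      fun _ x => Real.exp (-(ε / 2) * (g x - μ))).symm
    simpa using this
  have hone : ∑ x, Real.exp (-(ε / 2) * (g x - μ)) ≤ N * Real.exp (ε ^ 2 / 4) := by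
    have h1 : ∀ x, Real.exp (-(ε / 2) * (g x - μ)) ≤ 1 + -(ε / 2) * (g x - μ) + ε ^ 2 / 4 := by
      intro x
      have hd : |g x - μ| ≤ 1 := abs_le.2 ⟨by linarith [hg0 x], by linarith [hg1 x]⟩
      have habs : |-(ε / 2) * (g x - μ)| ≤ ε / 2 := by
        rw [abs_mul, abs_neg, abs_of_nonneg (by positivity)]
        nlinarith [abs_nonneg (g x - μ)]
      have h2 := Real.abs_exp_sub_one_sub_id_le (habs.trans (by linarith))
      have h3 : (-(ε / 2) * (g x - μ)) ^ 2 ≤ (ε / 2) ^ 2 := sq_le_sq' (by linarith [abs_le.1 habs])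
        (abs_le.1 habs).2
      have h4 := (abs_le.1 h2).2
      nlinarith
    refine (sum_le_sum fun x _ => h1 x).trans ?_
    have h5 : ∑ x, (1 + -(ε / 2) * (g x - μ) + ε ^ 2 / 4) = N * (ε ^ 2 / 4 + 1) := by
      rw [sum_add_distrib, sum_add_distrib, ← mul_sum, sum_sub_distrib, hμ]
      simp only [sum_const, card_univ, nsmul_eq_mul, ← hN]
      ring
    rw [h5]
    exact mul_le_mul_of_nonneg_left (Real.add_one_le_exp _) (by positivity)
  have hbad : (#{p : Fin m → X | ∑ j, g (p j) ≤ m * (μ - ε)} : ℝ) * Real.exp (ε ^ 2 / 2 * m) ≤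
      ∑ p : Fin m → X, ∏ j, Real.exp (-(ε / 2) * (g (p j) - μ)) := by
    rw [← nsmul_eq_mul]
    refine (card_nsmul_le_sum _ _ _ fun p hp => ?_).trans
      (sum_le_sum_of_subset_of_nonneg (subset_univ _) fun _ _ _ => by positivity)
    rw [← Real.exp_sum, Real.exp_le_exp, ← mul_sum, sum_sub_distrib]
    simp only [mem_filter, mem_univ, true_and] at hp
    simp only [sum_const, card_univ, Fintype.card_fin, nsmul_eq_mul]
    nlinarith
  have hfin : (∑ x, Real.exp (-(ε / 2) * (g x - μ))) ^ m ≤ N ^ m * Real.exp (ε ^ 2 / 4 * m) := by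
    refine (pow_le_pow_left₀ (by positivity) hone m).trans_eq ?_
    rw [mul_pow, ← Real.exp_nat_mul, mul_comm (m : ℝ)]
  have hexp : Real.exp (ε ^ 2 / 4 * m) =
      Real.exp (-(ε ^ 2 / 4 * m)) * Real.exp (ε ^ 2 / 2 * m) := by
    rw [← Real.exp_add]; congr 1; ring
  rw [hprod] at hbad
  refine le_of_mul_le_mul_right ((hbad.trans hfin).trans_eq ?_) (Real.exp_pos (ε ^ 2 / 2 * m))
  rw [hexp, mul_assoc]

open Finset in
/-- Resampling one coordinate. -/
theorem card_mul_card_resample [DecidableEq X] (i : Fin m) (C : X → (Fin m → X) → Prop)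
    [∀ x p, Decidable (C x p)] (hC : ∀ x p y, C x (Function.update p i y) ↔ C x p) :
    Fintype.card X * #{p | C (p i) p} = ∑ x, #{p | C x p} := by
  have h1 : ∑ x, #{p | C x p} = #{z : X × (Fin m → X) | C z.1 z.2} := by
    simp only [card_filter, Fintype.sum_prod_type]
  have h2 : Fintype.card X * #{p | C (p i) p} = #{z : X × (Fin m → X) | C (z.2 i) z.2} := by
    rw [card_filter, card_filter, Fintype.sum_prod_type]
    exact ((sum_const _).trans (smul_eq_mul _ _)).symm
  rw [h1, h2]
  refine card_nbij' (fun z => (z.2 i, Function.update z.2 i z.1))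
    (fun z => (z.2 i, Function.update z.2 i z.1)) ?_ ?_ ?_ ?_
  · intro z hz
    simpa [hC] using hz
  · intro z hz
    simpa [hC] using hz
  · intro z _
    simp
  · intro z _
    simp

open Finset in
theorem card_coord_eq [DecidableEq X] [Nonempty X] (i : Fin m) (f : (Fin m → X) → X)
    (hf : ∀ p y, f (Function.update p i y) = f p) :
    Fintype.card X * #{p | p i = f p} = Fintype.card X ^ m := by
  rw [card_mul_card_resample i (fun x p => x = f p) fun x p y => by rw [hf]]
  simp only [card_filter]
  rw [sum_comm]
  simp

open Finset in
theorem card_conditional_tail_le [DecidableEq X] [Nonempty X] {g : X → X → ℝ}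
    (hg0 : ∀ x y, 0 ≤ g x y)
    (hg1 : ∀ x y, g x y ≤ 1) {ε : ℝ} (hε : 0 < ε) (hε2 : ε ≤ 2) (hm : 2 ≤ ε * m) (i : Fin m) :
    (#{p : Fin m → X |
        ∑ j ∈ univ.erase i, g (p i) (p j) < m * ((∑ y, g (p i) y) / Fintype.card X - ε)} : ℝ) ≤
      (Fintype.card X : ℝ) ^ m * Real.exp (-(ε ^ 2 / 16 * m)) := by
  classical
  have hN0 : (0 : ℝ) < Fintype.card X := by exact_mod_cast Fintype.card_pos
  have h1 := card_mul_card_resample i (fun (x : X) (p : Fin m → X) =>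
    ∑ j ∈ univ.erase i, g x (p j) < m * ((∑ y, g x y) / Fintype.card X - ε)) (fun x p y => by
      rw [sum_congr rfl fun j hj => by rw [Function.update_of_ne (ne_of_mem_erase hj)]])
  have h2 : ∀ x, (#{p : Fin m → X |
      ∑ j ∈ univ.erase i, g x (p j) < m * ((∑ y, g x y) / Fintype.card X - ε)} : ℝ) ≤
        (Fintype.card X : ℝ) ^ m * Real.exp (-(ε ^ 2 / 16 * m)) := by
    intro x
    have h3 := card_lower_tail_le (m := m) (hg0 x) (hg1 x)
      (μ := (∑ y, g x y) / Fintype.card X) (ε := ε / 2) (by field_simp)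
      (div_nonneg (sum_nonneg fun y _ => hg0 x y) hN0.le)
      (by
        rw [div_le_one hN0]
        refine (sum_le_sum fun y _ => hg1 x y).trans_eq (by simp)) (by linarith) (by linarith)
    refine le_trans ?_ (h3.trans_eq (by ring_nf))
    refine Nat.cast_le.2 (card_le_card fun p hp => ?_)
    simp only [mem_filter, mem_univ, true_and] at hp ⊢
    rw [← add_sum_erase _ _ (mem_univ i)]
    linarith [hg1 x (p i)]
  have h4 : (Fintype.card X : ℝ) * (#{p : Fin m → X |
      ∑ j ∈ univ.erase i, g (p i) (p j) < m * ((∑ y, g (p i) y) / Fintype.card X - ε)} : ℝ) ≤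
        Fintype.card X * ((Fintype.card X : ℝ) ^ m * Real.exp (-(ε ^ 2 / 16 * m))) := by
    have h5 := sum_le_sum fun x (_ : x ∈ (univ : Finset X)) => h2 x
    rw [sum_const, card_univ, nsmul_eq_mul] at h5
    refine le_trans (le_of_eq ?_) h5
    exact_mod_cast h1
  exact le_of_mul_le_mul_left h4 hN0

open Finset in
/-- A positive proportion of all `m`-tuples sample given kernels accurately from below. -/
theorem exists_sample_size (κ : Type*) [Fintype κ] {ε : ℝ} (hε : 0 < ε) (hε2 : ε ≤ 2) :
    ∃ m₀ : ℕ, ∀ m ≥ m₀, ∃ N₀ : ℕ, ∀ (X : Type*) [Fintype X] [DecidableEq X] (x₀ : X)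
      (g : κ → X → X → ℝ), N₀ ≤ Fintype.card X → (∀ k x y, 0 ≤ g k x y) → (∀ k x y, g k x y ≤ 1) →
      ∃ S : Finset (Fin m → X), 1 / 2 * (Fintype.card X : ℝ) ^ m ≤ #S ∧ ∀ p ∈ S,
        Function.Injective p ∧ (∀ i, p i ≠ x₀) ∧ ∀ k i,
          m * ((∑ y, g k (p i) y) / Fintype.card X - ε) ≤ ∑ j ∈ univ.erase i, g k (p i) (p j) := by
  have hlim : Filter.Tendsto (fun m : ℕ => Fintype.card κ * (m * Real.exp (-(ε ^ 2 / 16 * m))))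
      Filter.atTop (nhds 0) := by
    have h1 := (Real.tendsto_pow_mul_exp_neg_atTop_nhds_zero 1).comp
      (tendsto_natCast_atTop_atTop.const_mul_atTop (by positivity : 0 < ε ^ 2 / 16))
    have h2 := h1.const_mul (Fintype.card κ * (16 / ε ^ 2))
    rw [mul_zero] at h2
    refine h2.congr fun m => ?_
    simp only [Function.comp, pow_one]
    field_simp
  obtain ⟨m₀, hm₀⟩ := Filter.eventually_atTop.1 (hlim.eventually (gt_mem_nhds (by norm_num :
    (0 : ℝ) < 1 / 4)))
  obtain ⟨m₁, hm₁⟩ := exists_nat_ge (2 / ε)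
  refine ⟨max m₀ m₁, fun m hm => ⟨4 * (m * m + m) + 1, fun X _ _ x₀ g hX hg0 hg1 => ?_⟩⟩
  classical
  have hm2 : 2 ≤ ε * m := by
    have h1 : (m₁ : ℝ) ≤ m := by exact_mod_cast (le_max_right _ _).trans hm
    have h2 := hm₁.trans h1
    rw [div_le_iff₀ hε] at h2
    linarith
  have : Nonempty X := ⟨x₀⟩
  have hN0 : (0 : ℝ) < Fintype.card X := by exact_mod_cast Fintype.card_pos
  let B₁ : κ × Fin m → Finset (Fin m → X) := fun z => {p | ∑ j ∈ univ.erase z.2,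
    g z.1 (p z.2) (p j) < m * ((∑ y, g z.1 (p z.2) y) / Fintype.card X - ε)}
  let B₂ : Fin m × Fin m → Finset (Fin m → X) := fun z => if z.1 = z.2 then ∅ else
    univ.filter fun p => p z.1 = p z.2
  let B₃ : Fin m → Finset (Fin m → X) := fun i => {p | p i = x₀}
  have hB₁ : (#(univ.biUnion B₁) : ℝ) ≤ 1 / 4 * (Fintype.card X : ℝ) ^ m := by
    have h1 : (#(univ.biUnion B₁) : ℝ) ≤ ∑ z, (#(B₁ z) : ℝ) := by exact_mod_cast card_biUnion_le
    refine h1.trans ((sum_le_sum fun z _ => card_conditional_tail_le (hg0 z.1) (hg1 z.1) hε hε2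
      hm2 z.2).trans ?_)
    rw [sum_const, card_univ, nsmul_eq_mul, Fintype.card_prod, Fintype.card_fin]
    have h2 := mul_le_mul_of_nonneg_right (hm₀ m ((le_max_left _ _).trans hm)).le
      (by positivity : 0 ≤ (Fintype.card X : ℝ) ^ m)
    refine le_trans (le_of_eq ?_) h2
    push_cast
    ring
  have hB₂₃ : (#(univ.biUnion B₂ ∪ univ.biUnion B₃) : ℝ) ≤ 1 / 4 * (Fintype.card X : ℝ) ^ m := by
    have h1 : Fintype.card X * #(univ.biUnion B₂ ∪ univ.biUnion B₃) ≤
        (m * m + m) * Fintype.card X ^ m := by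
      have h2 : ∀ z, Fintype.card X * #(B₂ z) ≤ Fintype.card X ^ m := by
        intro z
        simp only [B₂]
        split_ifs with h
        · simp
        · exact (card_coord_eq z.1 (fun p => p z.2) fun p y =>
            Function.update_of_ne (Ne.symm h) _ _).le
      have h3 : ∀ i, Fintype.card X * #(B₃ i) ≤ Fintype.card X ^ m := fun i =>
        (card_coord_eq i (fun _ => x₀) fun _ _ => rfl).le
      have h4 : #(univ.biUnion B₂ ∪ univ.biUnion B₃) ≤ ∑ z, #(B₂ z) + ∑ i, #(B₃ i) :=
        (card_union_le _ _).trans (add_le_add card_biUnion_le card_biUnion_le)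
      refine (Nat.mul_le_mul_left _ h4).trans ?_
      rw [mul_add, mul_sum, mul_sum]
      refine (add_le_add (sum_le_sum fun z _ => h2 z) (sum_le_sum fun i _ => h3 i)).trans_eq ?_
      simp [add_mul]
    have h5 : (Fintype.card X : ℝ) * #(univ.biUnion B₂ ∪ univ.biUnion B₃) ≤
        (m * m + m) * (Fintype.card X : ℝ) ^ m := by exact_mod_cast h1
    have h6 : (4 * (m * m + m) : ℝ) ≤ Fintype.card X := by
      have : 4 * (m * m + m) ≤ Fintype.card X := by omega
      exact_mod_cast this
    have h7 := mul_le_mul_of_nonneg_right h6 (by positivity : 0 ≤ (Fintype.card X : ℝ) ^ m)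
    refine le_of_mul_le_mul_left ?_ hN0
    linarith
  refine ⟨(univ.biUnion B₁ ∪ (univ.biUnion B₂ ∪ univ.biUnion B₃))ᶜ, ?_, fun p hp => ?_⟩
  · have h1 := card_compl_add_card (univ.biUnion B₁ ∪ (univ.biUnion B₂ ∪ univ.biUnion B₃))
    have h2 := card_union_le (univ.biUnion B₁) (univ.biUnion B₂ ∪ univ.biUnion B₃)
    rw [Fintype.card_fun, Fintype.card_fin] at h1
    have h3 : ((Fintype.card X : ℝ)) ^ m ≤
        #(univ.biUnion B₁ ∪ (univ.biUnion B₂ ∪ univ.biUnion B₃))ᶜ +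
          (#(univ.biUnion B₁) + #(univ.biUnion B₂ ∪ univ.biUnion B₃)) := by
      have : Fintype.card X ^ m ≤ #(univ.biUnion B₁ ∪ (univ.biUnion B₂ ∪ univ.biUnion B₃))ᶜ +
          (#(univ.biUnion B₁) + #(univ.biUnion B₂ ∪ univ.biUnion B₃)) := by omega
      exact_mod_cast this
    linarith
  · simp only [mem_compl, mem_union, not_or, mem_biUnion, mem_univ, true_and, not_exists] at hp
    obtain ⟨hp1, hp2, hp3⟩ := hp
    refine ⟨fun i j hij => ?_, fun i hi => hp3 i (by simpa [B₃] using hi), fun k i => ?_⟩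
    · by_contra hne
      exact hp2 (i, j) (by simpa [B₂, hne] using hij)
    · have := hp1 (k, i)
      simpa [B₁] using this

end Sampling

section Pieces

variable {α : Type*} [Fintype α] {q : ℕ} {a ρ η : ℝ}

open Finset in
/-- Sampling whole pieces of a partition, for relations between elements of the pieces. -/
theorem exists_piece_sample_size [Nonempty α] (κ : Type*) [Fintype κ] {ε : ℝ} (hε : 0 < ε)
    (hε2 : ε ≤ 2) :
    ∃ m₀ : ℕ, ∀ m ≥ m₀, ∃ N₀ : ℕ, ∀ (X : Type*) [Fintype X] [DecidableEq X] (x₀ : X)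
      (D : κ → X × α → X × α → Prop) [∀ k z w, Decidable (D k z w)], N₀ ≤ Fintype.card X →
      ∃ S : Finset (Fin m → X), 1 / 2 * (Fintype.card X : ℝ) ^ m ≤ #S ∧ ∀ p ∈ S,
        Function.Injective p ∧ (∀ i, p i ≠ x₀) ∧ ∀ k (z : Fin m × α),
          Fintype.card (Fin m × α) *
            (#{w | D k (p z.1, z.2) w} / Fintype.card (X × α) - ε) ≤
              #{w : Fin m × α | w.1 ≠ z.1 ∧ D k (p z.1, z.2) (p w.1, w.2)} := by
  classical
  obtain ⟨m₀, hm₀⟩ := exists_sample_size (κ × α) hε hε2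
  refine ⟨m₀, fun m hm => ?_⟩
  obtain ⟨N₀, hN₀⟩ := hm₀ m hm
  refine ⟨N₀, fun X _ _ x₀ D _ hX => ?_⟩
  have hh : (0 : ℝ) < Fintype.card α := by exact_mod_cast Fintype.card_pos
  obtain ⟨S, hS, hSp⟩ := hN₀ X x₀
    (fun k x y => (#{b | D k.1 (x, k.2) (y, b)} : ℝ) / Fintype.card α) hX
    (fun _ _ _ => by positivity) (fun k x y => by
      rw [div_le_one hh]
      exact_mod_cast card_le_univ _)
  refine ⟨S, hS, fun p hp => ⟨(hSp p hp).1, (hSp p hp).2.1, fun k z => ?_⟩⟩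
  have h1 := (hSp p hp).2.2 (k, z.2) z.1
  rw [← sum_div, ← sum_div, le_div_iff₀ hh] at h1
  have h2 : ∑ y, (#{b | D k (p z.1, z.2) (y, b)} : ℝ) = #{w | D k (p z.1, z.2) w} := by
    norm_cast
    simp only [card_filter, Fintype.sum_prod_type]
  have h3 : ∑ j ∈ univ.erase z.1, (#{b | D k (p z.1, z.2) (p j, b)} : ℝ) =
      #{w : Fin m × α | w.1 ≠ z.1 ∧ D k (p z.1, z.2) (p w.1, w.2)} := by
    norm_cast
    simp only [card_filter, Fintype.sum_prod_type, ite_and]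
    rw [← filter_ne', sum_filter]
    refine sum_congr rfl fun j _ => ?_
    split_ifs <;> simp
  simp only [h2, h3] at h1
  refine le_trans (le_of_eq ?_) h1
  rw [Fintype.card_prod, Fintype.card_prod, Fintype.card_fin, div_div]
  push_cast
  rw [mul_comm (Fintype.card α : ℝ) (Fintype.card X : ℝ)]
  ring

variable {X β : Type*} [Fintype β] {G : SimpleGraph β} {m : ℕ}

/-- The graph on a sample of pieces and an exceptional piece, without the edges inside pieces. -/
def sampleType (G : SimpleGraph β) (P : X × α ≃ β) (x₀ : X) (p : Fin m → X) :
    SimpleGraph (Option (Fin m) × α) where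
  Adj z w := z.1 ≠ w.1 ∧ G.Adj (P (z.1.elim x₀ p, z.2)) (P (w.1.elim x₀ p, w.2))
  symm := ⟨fun _ _ h => ⟨h.1.symm, h.2.symm⟩⟩
  loopless := ⟨fun _ h => h.1 rfl⟩

open Finset in
theorem card_filter_equiv_eq_degN [Fintype X] (P : X × α ≃ β) (v : β)
    [DecidablePred fun w => G.Adj v (P w)] :
    #{w | G.Adj v (P w)} = degN G v := by
  classical
  rw [degN_eq_card]
  refine card_bij (fun w _ => P w) (by simp) (fun _ _ _ _ h => P.injective h) fun b hb => ?_
  exact ⟨P.symm b, by simpa using hb, by simp⟩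

open Finset in
theorem isGoodType_sampleType [Fintype X] [DecidableEq X] (hm : 0 < m) (ha : 0 < a) (hρ : 0 < ρ) (hρ1 : ρ ≤ 1)
    (hη : 0 < η) (hG : DegCond G q a ρ η) (P : X × α ≃ β) (x₀ : X) (p : Fin m → X)
    (D : Fin 3 → X × α → X × α → Prop) [∀ k z w, Decidable (D k z w)]
    (hD0 : ∀ z w, D 0 z w ↔ G.Adj (P z) (P w))
    (hD1 : ∀ z w, D 1 z w ↔ degN G (P z) < degN G (P w))
    (hD2 : ∀ z w, D 2 z w ↔ G.Adj (P (x₀, z.2)) (P w))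
    (hp : ∀ k (z : Fin m × α), Fintype.card (Fin m × α) *
      (#{w | D k (p z.1, z.2) w} / Fintype.card (X × α) - η / 4) ≤
        #{w : Fin m × α | w.1 ≠ z.1 ∧ D k (p z.1, z.2) (p w.1, w.2)}) :
    IsGoodType q a ρ (η / 2) (sampleType G P x₀ p) := by
  classical
  have hcard : Fintype.card (X × α) = Fintype.card β := Fintype.card_congr P
  set M : ℝ := (Fintype.card (Fin m × α) : ℝ) with hM
  set n : ℝ := (Fintype.card β : ℝ) with hn
  have hM0 : 0 ≤ M := by positivity
  simp only [hcard, ← hn] at hp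
  have hn0 : Nonempty α → 0 < n := fun ⟨b⟩ => by
    have : Nonempty β := ⟨P (x₀, b)⟩
    exact Nat.cast_pos.2 Fintype.card_pos
  refine ⟨fun S hS => ?_, fun b => ?_⟩
  · obtain ⟨z, hz, hzmax⟩ := exists_max_image S (fun w => degN G (P (p w.1, w.2))) hS
    refine ⟨z, hz, ?_⟩
    have hn0 := hn0 ⟨z.2⟩
    set v := P (p z.1, z.2) with hv
    set L : Finset β := {y | degN G y ≤ degN G v} with hL
    obtain ⟨y, hy, hdeg⟩ := hG L ⟨v, by simp [hL]⟩
    have hyv : (degN G y : ℝ) ≤ degN G v := by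
      simp only [hL, mem_filter, mem_univ, true_and] at hy
      exact_mod_cast hy
    have h0 := hp 0 z
    have h1 := hp 1 z
    simp only [hD0, hD1, ← hv] at h0 h1
    rw [card_filter_equiv_eq_degN] at h0
    have h0' : #{w : Fin m × α | w.1 ≠ z.1 ∧ G.Adj v (P (p w.1, w.2))} = degN
        ((sampleType G P x₀ p).comap fun y : Fin m × α => (some y.1, y.2)) z := by
      rw [degN_eq_card]
      congr 1
      ext w
      simp [sampleType, hv, eq_comm]
    rw [h0'] at h0
    have h2 : (#{w : X × α | degN G v < degN G (P w)} : ℝ) = n - #L := by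
      have e1 : #{w : X × α | degN G v < degN G (P w)} = #Lᶜ := by
        refine card_bij (fun w _ => P w) (by simp [hL]) (fun _ _ _ _ h => P.injective h)
          fun b hb => ⟨P.symm b, by simpa [hL] using hb, by simp⟩
      rw [e1, card_compl, Nat.cast_sub (card_le_univ _)]
    have h3 : (#{w : Fin m × α | w.1 ≠ z.1 ∧ degN G v < degN G (P (p w.1, w.2))} : ℝ) ≤
        M - #S := by
      have e1 : #{w : Fin m × α | w.1 ≠ z.1 ∧ degN G v < degN G (P (p w.1, w.2))} ≤ #Sᶜ := by
        refine card_le_card fun w hw => ?_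
        simp only [mem_filter, mem_univ, true_and] at hw
        rw [mem_compl]
        exact fun hwS => absurd (hzmax w hwS) (not_le.2 hw.2)
      rw [hM, ← Nat.cast_sub (card_le_univ _), ← card_compl]
      exact_mod_cast e1
    rw [h2] at h1
    have h4 : (#S : ℝ) ≤ M * (#L / n + η / 4) := by
      have : (n - #L) / n = 1 - #L / n := by field_simp
      rw [this] at h1
      linarith
    have h5 : q * a + ρ * min (#L / n : ℝ) a + η ≤ degN G v / n := by
      rw [le_div_iff₀ hn0]
      refine le_trans (le_of_eq ?_) (hdeg.trans hyv)
      rw [add_mul, add_mul, mul_assoc ρ, min_mul_of_nonneg _ _ hn0.le]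
      congr 4
      field_simp
    have h6 : min (#S : ℝ) (a * M) ≤ M * min (#L / n : ℝ) a + M * (η / 4) := by
      rw [mul_min_of_nonneg _ _ hM0, ← min_add_add_right]
      refine min_le_min (by linarith) ?_
      have := mul_nonneg hM0 hη.le
      linarith
    have h7 : ρ * min (#S : ℝ) (a * M) ≤ ρ * (M * min (#L / n : ℝ) a) + M * (η / 4) := by
      have e1 := mul_le_mul_of_nonneg_left h6 hρ.le
      have e2 := mul_le_mul_of_nonneg_right hρ1 (by positivity : 0 ≤ M * (η / 4))
      linarith
    have h8 := mul_le_mul_of_nonneg_left h5 hM0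
    linarith
  · have hn0 := hn0 ⟨b⟩
    have h2 := hp 2 (⟨0, hm⟩, b)
    simp only [hD2] at h2
    rw [card_filter_equiv_eq_degN] at h2
    have h3 : #{w : Fin m × α | w.1 ≠ ⟨0, hm⟩ ∧ G.Adj (P (x₀, b)) (P (p w.1, w.2))} ≤
        {y : Fin m × α | (sampleType G P x₀ p).Adj (none, b) (some y.1, y.2)}.ncard := by
      rw [← Set.ncard_coe_finset]
      refine Set.ncard_le_ncard (fun w hw => ?_) (Set.toFinite _)
      simp only [coe_filter, mem_univ, true_and, Set.mem_ofPred_eq] at hw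
      exact ⟨by simp, hw.2⟩
    have h4 : q * a + η ≤ degN G (P (x₀, b)) / n := by
      rw [le_div_iff₀ hn0]
      exact hG.le_degN ha hρ _
    have h5 := mul_le_mul_of_nonneg_left h4 hM0
    have h6 := mul_nonneg hM0 hη.le
    have h7 := h2.trans (Nat.cast_le.2 h3)
    linarith

end Pieces

section Global

variable {α : Type u} [Fintype α] {H : SimpleGraph α} {q : ℕ} {a ρ η : ℝ}

theorem DegCond.mono {Y : Type*} [Fintype Y] {R : SimpleGraph Y} {η' : ℝ}
    (hR : DegCond R q a ρ η) (h : η' ≤ η) : DegCond R q a ρ η' := fun S hS => by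
  obtain ⟨x, hx, hdeg⟩ := hR S hS
  refine ⟨x, hx, le_trans ?_ hdeg⟩
  gcongr

/-- Some blow-up size works for all good types of a given size. -/
theorem exists_uniform_blow_up {m : ℕ} (hm : 0 < m) (hH : IsTilingParam H q a ρ) (hη : 0 < η) :
    ∃ t : ℕ, ∀ R : SimpleGraph (Option (Fin m) × α), IsGoodType q a ρ η R →
      ∃ e : Equiv.Perm (Option (Fin m × Fin t) × α), ∀ j, ∃ ψ : H →g R,
        ∀ u, blowClass (e (j, u)) = ψ u := by
  classical
  have : NeZero m := ⟨hm.ne'⟩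
  have key : ∀ R : SimpleGraph (Option (Fin m) × α), ∃ t₀ : ℕ, IsGoodType q a ρ η R → ∀ t ≥ t₀,
      ∃ e : Equiv.Perm (Option (Fin m × Fin t) × α), ∀ j, ∃ ψ : H →g R,
        ∀ u, blowClass (e (j, u)) = ψ u := fun R => by
    by_cases hR : IsGoodType q a ρ η R
    · obtain ⟨t₀, ht₀⟩ := exists_local_rearrangement hH hη hR
      exact ⟨t₀, fun _ => ht₀⟩
    · exact ⟨0, fun h => absurd h hR⟩
  choose t₀ ht₀ using key
  exact ⟨Finset.univ.sup t₀, fun R hR => ht₀ R hR _ (Finset.le_sup (Finset.mem_univ R))⟩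

variable {X β : Type*} {G : SimpleGraph β} {m t : ℕ}

/-- A family of boxes, together with the exceptional piece. -/
def boxPiece (x₀ : X) (τ : Fin m → Fin t → X) (o : Option (Fin m × Fin t)) : X :=
  o.elim x₀ fun z => τ z.1 z.2

theorem exists_transversal {x₀ : X} {τ : Fin m → Fin t → X} {S : Set (Fin m → X)}
    (hτ : ∀ s : Fin m → Fin t, (fun i => τ i (s i)) ∈ S) {o o' : Option (Fin m × Fin t)}
    (h : o.map Prod.fst ≠ o'.map Prod.fst) :
    ∃ p ∈ S, (o.map Prod.fst).elim x₀ p = boxPiece x₀ τ o ∧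
      (o'.map Prod.fst).elim x₀ p = boxPiece x₀ τ o' := by
  rcases o with _ | ⟨i, s⟩ <;> rcases o' with _ | ⟨i', s'⟩
  · exact absurd rfl h
  · exact ⟨_, hτ fun _ => s', rfl, rfl⟩
  · exact ⟨_, hτ fun _ => s, rfl, rfl⟩
  · have hne : i ≠ i' := fun h' => h (by simp [h'])
    exact ⟨_, hτ fun k => if k = i then s else s', by simp [boxPiece],
      by simp [boxPiece, hne.symm]⟩

theorem boxPiece_injective {x₀ : X} {τ : Fin m → Fin t → X} {S : Set (Fin m → X)}
    (hτ : ∀ s : Fin m → Fin t, (fun i => τ i (s i)) ∈ S) (hτi : ∀ i, Function.Injective (τ i))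
    (hS : ∀ p ∈ S, Function.Injective p ∧ ∀ i, p i ≠ x₀) :
    Function.Injective (boxPiece x₀ τ) := by
  intro o o' hoo
  by_cases h : o.map Prod.fst = o'.map Prod.fst
  · rcases o with _ | ⟨i, s⟩ <;> rcases o' with _ | ⟨i', s'⟩
    · rfl
    · simp at h
    · simp at h
    · simp only [Option.map_some, Option.some.injEq] at h
      subst h
      have hss : s = s' := hτi i hoo
      rw [hss]
  · obtain ⟨p, hp, h1, h2⟩ := exists_transversal (x₀ := x₀) hτ h
    rw [← h1, ← h2] at hoo
    refine absurd ?_ h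
    generalize o.map Prod.fst = k at hoo
    generalize o'.map Prod.fst = k' at hoo
    rcases k with _ | k <;> rcases k' with _ | k'
    · rfl
    · exact absurd hoo.symm ((hS p hp).2 k')
    · exact absurd hoo ((hS p hp).2 k)
    · rw [(hS p hp).1 hoo]

open Finset in
/-- If a partition into pieces has an exceptional piece and a box of tuples of the same good type,
then the number of pieces which are copies of `H` can be increased. -/
theorem exists_more_copies [Fintype X] (P : X × α ≃ β) {x₀ : X}
    (hx₀ : ¬ IsCopy H G fun u => P (x₀, u)) {R : SimpleGraph (Option (Fin m) × α)}
    {τ : Fin m → Fin t → X} (hτi : ∀ i, Function.Injective (τ i)) {S : Set (Fin m → X)}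
    (hτ : ∀ s : Fin m → Fin t, (fun i => τ i (s i)) ∈ S)
    (hS : ∀ p ∈ S, Function.Injective p ∧ ∀ i, p i ≠ x₀)
    (hSne : S.Nonempty) (hR : ∀ p ∈ S, sampleType G P x₀ p = R)
    {e : Equiv.Perm (Option (Fin m × Fin t) × α)}
    (he : ∀ j, ∃ ψ : H →g R, ∀ u, blowClass (e (j, u)) = ψ u) :
    ∃ P' : X × α ≃ β, {x | IsCopy H G fun u => P (x, u)}.ncard <
      {x | IsCopy H G fun u => P' (x, u)}.ncard := by
  classical
  have hinj := boxPiece_injective (x₀ := x₀) hτ hτi hS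
  let emb : Option (Fin m × Fin t) × α ↪ X × α :=
    Function.Embedding.prodMap ⟨boxPiece x₀ τ, hinj⟩ (Function.Embedding.refl α)
  let P' : X × α ≃ β := (e.viaEmbedding emb).trans P
  have hcopy : ∀ j, IsCopy H G fun u => P' (boxPiece x₀ τ j, u) := by
    intro j
    refine ⟨fun u v h => (Prod.mk.inj (P'.injective h)).2, fun u v huv => ?_⟩
    obtain ⟨ψ, hψ⟩ := he j
    have hadj := ψ.map_rel huv
    rw [← hψ, ← hψ] at hadj
    have hval : ∀ w, P' (boxPiece x₀ τ j, w) =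
        P (boxPiece x₀ τ (e (j, w)).1, (e (j, w)).2) := fun w =>
      congrArg P (Equiv.Perm.viaEmbedding_apply e emb (j, w))
    simp only [hval]
    have hne : (e (j, u)).1.map Prod.fst ≠ (e (j, v)).1.map Prod.fst := by
      obtain ⟨p, hp⟩ := hSne
      rw [← hR p hp] at hadj
      exact hadj.1
    obtain ⟨p, hp, h1, h2⟩ := exists_transversal (x₀ := x₀) hτ hne
    rw [← hR p hp] at hadj
    have := hadj.2
    simpa only [blowClass, h1, h2] using this
  refine ⟨P', Set.ncard_lt_ncard ⟨fun x hx => ?_, fun hsub => ?_⟩ (Set.toFinite _)⟩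
  · by_cases hxr : ∃ j, boxPiece x₀ τ j = x
    · obtain ⟨j, rfl⟩ := hxr
      exact hcopy j
    · have hval : ∀ w, P' (x, w) = P (x, w) := fun w =>
        congrArg P (Equiv.Perm.viaEmbedding_apply_of_notMem e emb (x, w) (by
          rintro ⟨z, hz⟩
          exact hxr ⟨z.1, congrArg Prod.fst hz⟩))
      simpa only [Set.mem_ofPred_eq, hval] using hx
  · exact hx₀ (hsub (hcopy none))

theorem hasPerfectTiling_of_pieces (P : X × α ≃ β)
    (hP : ∀ x, IsCopy H G fun u => P (x, u)) : HasPerfectTiling H G := by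
  refine ⟨Set.range fun x u => P (x, u), ⟨?_, ?_⟩, fun v => ?_⟩
  · rintro _ ⟨x, rfl⟩
    exact hP x
  · rintro _ ⟨x, rfl⟩ _ ⟨y, rfl⟩ hxy
    rw [Set.disjoint_left]
    rintro _ ⟨u, rfl⟩ ⟨w, hw⟩
    have hyx := (Prod.mk.inj (P.injective hw)).1
    subst hyx
    exact hxy rfl
  · exact ⟨_, ⟨(P.symm v).1, rfl⟩, (P.symm v).2, by simp⟩

open Finset in
/-- The degree sequence condition forces perfect tilings in large graphs. -/
theorem exists_hasPerfectTiling (hH : IsTilingParam H q a ρ) (hη : 0 < η) :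
    ∃ n₀ : ℕ, ∀ (β : Type) [Fintype β] (G : SimpleGraph β), n₀ ≤ Fintype.card β →
      Fintype.card α ∣ Fintype.card β → DegCond G q a ρ η → HasPerfectTiling H G := by
  classical
  have hα := hH.card_pos
  have : Nonempty α := Fintype.card_pos_iff.1 hα
  set η' := min η 1 with hη'
  have hη'0 : 0 < η' := lt_min hη one_pos
  obtain ⟨m₀, hm₀⟩ := exists_piece_sample_size (α := α) (Fin 3) (by positivity : 0 < η' / 4)
    (by linarith [min_le_right η 1])
  obtain ⟨N₁, hN₁⟩ := hm₀ (max m₀ 1) (le_max_left _ _)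
  have hm : 0 < max m₀ 1 := by simp
  generalize max m₀ 1 = m at hN₁ hm
  obtain ⟨t, ht⟩ := exists_uniform_blow_up hm hH (half_pos hη'0)
  have hfin : Fintype (SimpleGraph (Option (Fin m) × α)) := Fintype.ofFinite _
  have hT : (0 : ℝ) < Fintype.card (SimpleGraph (Option (Fin m) × α)) := by
    exact_mod_cast Fintype.card_pos
  set T := Fintype.card (SimpleGraph (Option (Fin m) × α)) with hTdef
  obtain ⟨N₂, hN₂⟩ := exists_box m t (by positivity : (0 : ℝ) < 1 / 2 / T)
  refine ⟨Fintype.card α * max N₁ N₂, fun β _ G hn hdvd hG => ?_⟩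
  obtain ⟨N, hN⟩ := hdvd
  rw [hN] at hn
  have hN' := Nat.le_of_mul_le_mul_left hn hα
  have hequiv : Nonempty (Fin N × α ≃ β) := ⟨Fintype.equivOfCardEq (by simp [hN, mul_comm])⟩
  obtain ⟨P, hPmax⟩ := Finite.exists_max fun P : Fin N × α ≃ β =>
    {x | IsCopy H G fun u => P (x, u)}.ncard
  by_cases hall : ∀ x, IsCopy H G fun u => P (x, u)
  · exact hasPerfectTiling_of_pieces P hall
  push Not at hall
  obtain ⟨x₀, hx₀⟩ := hall
  let D : Fin 3 → Fin N × α → Fin N × α → Prop :=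
    ![fun z w => G.Adj (P z) (P w), fun z w => degN G (P z) < degN G (P w),
      fun z w => G.Adj (P (x₀, z.2)) (P w)]
  obtain ⟨S, hScard, hS⟩ := hN₁ (Fin N) x₀ D (by simpa using (le_max_left _ _).trans hN')
  have hgood : ∀ p ∈ S, IsGoodType q a ρ (η' / 2) (sampleType G P x₀ p) := fun p hp =>
    isGoodType_sampleType hm hH.a_pos hH.ρ_pos hH.ρ_le hη'0 (hG.mono (min_le_left _ _)) P x₀ p D
      (fun _ _ => Iff.rfl) (fun _ _ => Iff.rfl) (fun _ _ => Iff.rfl) (hS p hp).2.2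
  have hpos : (0 : ℝ) < Fintype.card (Fin N) := by
    have : Nonempty (Fin N) := ⟨x₀⟩
    exact_mod_cast Fintype.card_pos
  obtain ⟨R, -, hR⟩ : ∃ R ∈ (univ : Finset (SimpleGraph (Option (Fin m) × α))),
      1 / 2 / T * (Fintype.card (Fin N) : ℝ) ^ m ≤ #{p ∈ S | sampleType G P x₀ p = R} := by
    by_contra! hcon
    have h1 := sum_lt_sum_of_nonempty univ_nonempty hcon
    rw [sum_const, card_univ, nsmul_eq_mul, ← hTdef] at h1
    have h2 : (∑ R, #{p ∈ S | sampleType G P x₀ p = R} : ℝ) = #S := by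
      exact_mod_cast (card_eq_sum_card_fiberwise fun _ _ => by simp).symm
    rw [h2] at h1
    refine absurd hScard (not_le.2 (h1.trans_eq ?_))
    field_simp
  obtain ⟨U, hU, hUS⟩ := hN₂ (Fin N) (by simpa using (le_max_right _ _).trans hN') _ hR
  have hne : {p ∈ S | sampleType G P x₀ p = R}.Nonempty := by
    rw [← card_pos]
    have : (0 : ℝ) < #{p ∈ S | sampleType G P x₀ p = R} := lt_of_lt_of_le (by positivity) hR
    exact_mod_cast this
  have hRgood : IsGoodType q a ρ (η' / 2) R := by
    obtain ⟨p, hp⟩ := hne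
    rw [mem_filter] at hp
    exact hp.2 ▸ hgood p hp.1
  obtain ⟨e, he⟩ := ht R hRgood
  obtain ⟨P', hP'⟩ := exists_more_copies P hx₀ (R := R)
    (τ := fun i s => ((U i).equivFinOfCardEq (hU i)).symm s)
    (S := {p | p ∈ S ∧ sampleType G P x₀ p = R})
    (fun i s s' h => ((U i).equivFinOfCardEq (hU i)).symm.injective (Subtype.ext h))
    (fun s => by simpa using hUS _ fun i => Subtype.coe_prop _)
    (fun p hp => ⟨(hS p hp.1).1, (hS p hp.1).2.1⟩)
    (by obtain ⟨p, hp⟩ := hne; exact ⟨p, by simpa using hp⟩) (fun p hp => hp.2) he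
  exact absurd (hPmax P') (not_le.2 hP')

end Global

section Reduction

open Finset in
theorem degCond_of_sorted {β : Type*} [Fintype β] {G : SimpleGraph β} {n q : ℕ} {a ρ η : ℝ}
    (hn : Fintype.card β = n) (hρ : 0 < ρ) (hρ1 : ρ ≤ 1) (e : Fin n ≃ β)
    (hmono : ∀ i j : Fin n, i ≤ j → degN G (e i) ≤ degN G (e j)) (hna : 1 < a * n)
    (hnη : 2 ≤ η * n)
    (hdeg : ∀ i : Fin n, ((i : ℕ) + 1 : ℝ) < a * n →
      q * a * n + ρ * ((i : ℕ) + 1) + η * n ≤ degN G (e i)) :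
    DegCond G q a ρ (η / 2) := by
  intro S hS
  have hk := card_pos.2 hS
  obtain ⟨x, hx, hxk⟩ : ∃ x ∈ S, #S ≤ (e.symm x : ℕ) + 1 := by
    by_contra! hcon
    have h1 : S.map ⟨fun x => (e.symm x : ℕ), fun x y h => e.symm.injective (Fin.ext h)⟩ ⊆
        range (#S - 1) := by
      intro y hy
      obtain ⟨x, hx, rfl⟩ := mem_map.1 hy
      have := hcon x hx
      rw [mem_range]
      change (e.symm x : ℕ) < #S - 1
      omega
    have h2 := card_le_card h1
    rw [card_map, card_range] at h2
    omega
  set j := min #S (⌈a * n⌉₊ - 1) with hj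
  have hceil : 2 ≤ ⌈a * n⌉₊ := Nat.lt_ceil.2 (by simpa using hna)
  have hj1 : 1 ≤ j := le_min hk (by omega)
  have hjk : j ≤ #S := min_le_left _ _
  have hjlt : j - 1 < n := by
    have := (e.symm x).isLt
    omega
  have hja : (j : ℝ) < a * n := Nat.lt_ceil.1 (by
    have : j ≤ ⌈a * n⌉₊ - 1 := min_le_right _ _
    omega)
  have hcast : (((⟨j - 1, hjlt⟩ : Fin n) : ℕ) : ℝ) + 1 = j := by
    have : j - 1 + 1 = j := by omega
    exact_mod_cast this
  have h1 := hdeg ⟨j - 1, hjlt⟩ (by rwa [hcast])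
  rw [hcast] at h1
  have h2 : (degN G (e ⟨j - 1, hjlt⟩) : ℝ) ≤ degN G x := by
    have := hmono ⟨j - 1, hjlt⟩ (e.symm x) (Fin.mk_le_of_le_val (by omega))
    rw [e.apply_symm_apply] at this
    exact_mod_cast this
  have h3 : min (#S : ℝ) (a * n) ≤ j + 1 := by
    rcases min_choice #S (⌈a * n⌉₊ - 1) with h | h
    · rw [hj, h]
      exact (min_le_left _ _).trans (by linarith)
    · refine (min_le_right _ _).trans ((Nat.le_ceil _).trans ?_)
      rw [hj, h]
      have : ⌈a * n⌉₊ ≤ ⌈a * n⌉₊ - 1 + 1 := by omega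
      exact_mod_cast this
  have h4 := mul_le_mul_of_nonneg_left h3 hρ.le
  refine ⟨x, hx, ?_⟩
  rw [hn]
  linarith

variable {α : Type*} [Fintype α] {H : SimpleGraph α} {q : ℕ}

theorem isTilingParam_one (hcol : H.Colorable (q + 2))
    (hsurj : ∀ c : H.Coloring (Fin (q + 2)), Function.Surjective c) :
    IsTilingParam H q (1 / (q + 2)) 1 where
  a_pos := by positivity
  ρ_pos := one_pos
  ρ_le := le_rfl
  sum_eq := by field_simp; ring
  exists_averaging := by
    obtain ⟨c⟩ := hcol
    obtain ⟨v, -⟩ := hsurj c 0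
    have : Nonempty α := ⟨v⟩
    exact ⟨c, _, isBottleAveraging_univ c⟩
  surjective := hsurj
  hcf := Or.inr rfl

open Finset in
theorem isTilingParam_minClassSize (hcol : H.Colorable (q + 2))
    (hsurj : ∀ c : H.Coloring (Fin (q + 2)), Function.Surjective c) (hhcf : HcfOne H (q + 2))
    {σ ω h : ℝ} (hσ : σ = minClassSize H (q + 2)) (hh : h = Fintype.card α)
    (hω : ω = (h - σ) / (q + 1)) : 0 < ω ∧ IsTilingParam H q (ω / h) (σ / ω) := by
  obtain ⟨c₀⟩ := hcol
  obtain ⟨c, i, hci⟩ := Nat.sInf_mem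
    (s := {s : ℕ | ∃ (c : H.Coloring (Fin (q + 2))) (i : Fin (q + 2)), s = {v | c v = i}.ncard})
    ⟨_, c₀, 0, rfl⟩
  have hncard : ∀ j, {v | c v = j}.ncard = #{v | c v = j} := fun j => by
    rw [← Set.ncard_coe_finset]
    simp
  change minClassSize H (q + 2) = _ at hci
  rw [hncard] at hci
  have hσ0 : 0 < σ := by
    obtain ⟨v, hv⟩ := hsurj c i
    have h1 : 0 < #{v | c v = i} := card_pos.2 ⟨v, by simpa using hv⟩
    rw [hσ, hci]
    exact_mod_cast h1
  have hα : 0 < Fintype.card α := by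
    obtain ⟨v, -⟩ := hsurj c i
    exact Fintype.card_pos_iff.2 ⟨v⟩
  have hh0 : 0 < h := by rw [hh]; exact_mod_cast hα
  have hsum : (q + 2) * σ ≤ h := by
    have h1 : ∑ j : Fin (q + 2), minClassSize H (q + 2) ≤ ∑ j, #{v | c v = j} :=
      sum_le_sum fun j _ => (hncard j).symm ▸ Nat.sInf_le ⟨c, j, rfl⟩
    rw [sum_class_card, sum_const, card_univ, Fintype.card_fin, smul_eq_mul] at h1
    rw [hσ, hh]
    exact_mod_cast h1
  have hq : (0 : ℝ) < q + 1 := by positivity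
  have hωmul : ω * (q + 1) = h - σ := by rw [hω]; field_simp
  have hσω : σ ≤ ω := by
    rw [hω, le_div_iff₀ hq]
    linarith
  have hω0 : 0 < ω := hσ0.trans_le hσω
  have hsum1 : ((q : ℝ) + 1) * (ω / h) + σ / ω * (ω / h) = 1 := by
    field_simp
    linarith
  refine ⟨hω0, div_pos hω0 hh0, div_pos hσ0 hω0, (div_le_one hω0).2 hσω, hsum1,
    ⟨c, _, isBottleAveraging_neck c i ?_ hsum1⟩, hsurj, Or.inl hhcf⟩
  rw [← hh, ← hci, ← hσ]
  field_simp

end Reduction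

/-- Theorem 1.7: degree sequence version of the Kühn–Osthus theorem. -/
theorem degreeSequence_KuhnOsthus_full
    {α : Type*} [Fintype α] (H : SimpleGraph α) (r : ℕ)
    (hr : 2 ≤ r) (hchi : H.chromaticNumber = (r : ℕ∞))
    (σ ω h : ℝ) (hσ : σ = (minClassSize H r : ℝ)) (hh : h = (Fintype.card α : ℝ))
    (hω : ω = (h - σ) / ((r : ℝ) - 1))
    (η : ℝ) (hη : 0 < η) :
    ∃ n₁ : ℕ, ∀ (β : Type) [Fintype β] (G : SimpleGraph β) (n : ℕ),
      Fintype.card β = n → n₁ ≤ n → Fintype.card α ∣ n →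
      ((HcfOne H r ∧
          ∃ e : Fin n ≃ β,
            (∀ i j : Fin n, i ≤ j → degN G (e i) ≤ degN G (e j)) ∧
            (∀ i : Fin n, ((i : ℕ) + 1 : ℝ) ≤ ω * n / h →
              (1 - (ω + σ) / h) * n + (σ / ω) * ((i : ℕ) + 1) + η * n ≤ (degN G (e i) : ℝ))) ∨
        (¬ HcfOne H r ∧
          ∃ e : Fin n ≃ β,
            (∀ i j : Fin n, i ≤ j → degN G (e i) ≤ degN G (e j)) ∧
            (∀ i : Fin n, ((i : ℕ) + 1 : ℝ) < (n : ℝ) / r →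
              ((r : ℝ) - 2) * n / r + ((i : ℕ) + 1) + η * n ≤ (degN G (e i) : ℝ)))) →
      HasPerfectTiling H G := by
  obtain ⟨q, rfl⟩ : ∃ q, r = q + 2 := ⟨r - 2, by omega⟩
  have hcol : H.Colorable (q + 2) := chromaticNumber_le_iff_colorable.1 hchi.le
  have hsurj := le_chromaticNumber_iff_forall_surjective.1 hchi.ge
  have hω' : ω = (h - σ) / (q + 1) := by
    rw [hω]
    push_cast
    ring
  by_cases hhcf : HcfOne H (q + 2)
  · obtain ⟨hω0, hH⟩ := isTilingParam_minClassSize hcol hsurj hhcf hσ hh hω'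
    obtain ⟨n₀, hn₀⟩ := exists_hasPerfectTiling hH (half_pos hη)
    obtain ⟨n₁, hn₁⟩ := exists_nat_gt (1 / (ω / h))
    obtain ⟨n₂, hn₂⟩ := exists_nat_ge (2 / η)
    refine ⟨max n₀ (max n₁ n₂), fun β _ G n hn hle hdvd hG => ?_⟩
    simp only [max_le_iff] at hle
    rcases hG with ⟨-, e, hmono, hdeg⟩ | ⟨h', -⟩
    · refine hn₀ β G (hle.1.trans_eq hn.symm) (hn ▸ hdvd)
        (degCond_of_sorted hn hH.ρ_pos hH.ρ_le e hmono ?_ ?_ fun i hi => ?_)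
      · have h1 : 1 / (ω / h) < n := hn₁.trans_le (by exact_mod_cast hle.2.1)
        rw [div_lt_iff₀ hH.a_pos] at h1
        linarith
      · have h1 : 2 / η ≤ n := hn₂.trans (by exact_mod_cast hle.2.2)
        rw [div_le_iff₀ hη] at h1
        linarith
      · have h1 := hdeg i (by rw [mul_div_right_comm]; exact hi.le)
        have h2 : 1 - (ω + σ) / h = q * (ω / h) := by
          have h3 := hH.sum_eq
          have h4 : σ / ω * (ω / h) = σ / h := by field_simp
          rw [add_div]
          linarith
        rwa [h2] at h1
    · exact absurd hhcf h'
  · have hH := isTilingParam_one hcol hsurj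
    obtain ⟨n₀, hn₀⟩ := exists_hasPerfectTiling hH (half_pos hη)
    obtain ⟨n₂, hn₂⟩ := exists_nat_ge (2 / η)
    refine ⟨max n₀ (max (q + 3) n₂), fun β _ G n hn hle hdvd hG => ?_⟩
    simp only [max_le_iff] at hle
    rcases hG with ⟨h', -⟩ | ⟨-, e, hmono, hdeg⟩
    · exact absurd h' hhcf
    · refine hn₀ β G (hle.1.trans_eq hn.symm) (hn ▸ hdvd)
        (degCond_of_sorted hn hH.ρ_pos hH.ρ_le e hmono ?_ ?_ fun i hi => ?_)
      · have h1 : (q + 3 : ℝ) ≤ n := by exact_mod_cast hle.2.1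
        rw [one_div_mul_eq_div, one_lt_div (by positivity)]
        linarith
      · have h1 : 2 / η ≤ n := hn₂.trans (by exact_mod_cast hle.2.2)
        rw [div_le_iff₀ hη] at h1
        linarith
      · have h1 := hdeg i (by
          push_cast
          rwa [← one_div_mul_eq_div])
        refine le_trans (le_of_eq ?_) h1
        push_cast
        ring
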